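/- arXiv:1812.11640 — 2 statements merged into one kernel-verified Lean document; each statement's English description precedes it below -/
import Mathlib

section
/- Let G be a finite simple graph, let r be a positive integer, and let n ≥ 1 be a real number. Suppose G is (r + 1/n)-iso-tough, meaning iso(G−S) ≤ |S|/(r + 1/n) for all S ⊆ V(G). Suppose further that ω(G−S) < |S|/n + 2 for all S ⊆ V(G), where ω denotes the number of connected components. Then G has a near r-factor: a spanning subgraph F in which every vertex has degree r, except possibly one vertex of degree r+1. -/
open Classical Finset

/-- The set of isolated vertices of `G − S`: vertices outside `S` all of whose
neighbors lie in `S`. -/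
def SimpleGraph.isoVerts {V : Type*} (G : SimpleGraph V) (S : Finset V) : Set V :=
  {v | v ∉ S ∧ ∀ w, G.Adj v w → w ∈ S}

/-- `iso(G − S)`, the number of isolated vertices of `G − S`. -/
noncomputable def SimpleGraph.isoCount {V : Type*} (G : SimpleGraph V) (S : Finset V) : ℕ :=
  (G.isoVerts S).ncard

/-- `ω(G − S)`, the number of connected components of `G − S`. -/
noncomputable def SimpleGraph.compCount {V : Type*} (G : SimpleGraph V) (S : Finset V) : ℕ :=
  Nat.card (G.induce ((↑S : Set V)ᶜ)).ConnectedComponent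

/-- `G` is `t`-tough: `ω(G−S) ≤ max {1, |S|/t}` for all `S ⊆ V(G)`. -/
def SimpleGraph.IsTough {V : Type*} [Fintype V] (t : ℝ) (G : SimpleGraph V) : Prop :=
  ∀ S : Finset V, (G.compCount S : ℝ) ≤ max 1 ((S.card : ℝ) / t)

/-- A near `r`-factor of `G`: a spanning subgraph in which every vertex has degree `r`,
except for at most one vertex, which has degree `r + 1`. -/
noncomputable def SimpleGraph.HasNearRegularFactor {V : Type*} [Fintype V]
    (G : SimpleGraph V) (r : ℕ) : Prop :=
  ∃ F : SimpleGraph V, F ≤ G ∧ (∀ v, F.degree v = r ∨ F.degree v = r + 1) ∧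
    ∀ u v, F.degree u = r + 1 → F.degree v = r + 1 → u = v

namespace SimpleGraph

section Isolate

variable {X Y : Type*}

/-- The graph on the same vertex set obtained by deleting all edges meeting `U`. -/
def isolate (H : SimpleGraph X) (U : Set X) : SimpleGraph X where
  Adj x y := H.Adj x y ∧ x ∉ U ∧ y ∉ U
  symm := ⟨fun _ _ h => ⟨h.1.symm, h.2.2, h.2.1⟩⟩
  loopless := ⟨fun _ h => H.irrefl h.1⟩

lemma isolate_anti (H : SimpleGraph X) {U U' : Set X} (h : U' ⊆ U) :
    H.isolate U ≤ H.isolate U' :=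
  fun _ _ hxy => ⟨hxy.1, fun hx => hxy.2.1 (h hx), fun hy => hxy.2.2 (h hy)⟩

/-- A component of `K` which stays closed under adjacency in a larger graph remains a
component there. -/
lemma ConnectedComponent.supp_map_ofLE_of_closed {K L : SimpleGraph X} (h : K ≤ L)
    (c : K.ConnectedComponent) (hc : ∀ x ∈ c.supp, ∀ y, L.Adj x y → y ∈ c.supp) :
    (c.map (Hom.ofLE h)).supp = c.supp := by
  ext y
  constructor
  · intro hy
    obtain ⟨x, rfl⟩ := c.exists_rep
    have hr : L.Reachable x y := (ConnectedComponent.eq.1 hy).symm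
    rw [reachable_iff_reflTransGen] at hr
    induction hr with
    | refl => rfl
    | tail _ hyz ih => exact hc _ (ih (ConnectedComponent.eq.2
        ((reachable_iff_reflTransGen _ _).2 ‹_›).symm)) _ hyz
  · rintro rfl
    rfl

lemma ncard_oddComponents_le_add [Finite X] {K L : SimpleGraph X} (h : K ≤ L)
    (A : Set K.ConnectedComponent)
    (hA : ∀ c ∉ A, ∀ x ∈ c.supp, ∀ y, L.Adj x y → y ∈ c.supp) :
    K.oddComponents.ncard ≤ L.oddComponents.ncard + A.ncard := by
  have hsupp : ∀ c ∉ A, (c.map (Hom.ofLE h)).supp = c.supp := fun c hc =>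
    c.supp_map_ofLE_of_closed h (hA c hc)
  have h1 : (K.oddComponents \ A).ncard ≤ L.oddComponents.ncard := by
    refine Set.ncard_le_ncard_of_injOn (fun c => c.map (Hom.ofLE h)) ?_ ?_ (Set.toFinite _)
    · intro c hc
      have : Odd c.supp.ncard := hc.1
      rw [← hsupp c hc.2] at this
      exact this
    · intro c hc d hd hcd
      apply ConnectedComponent.supp_injective
      rw [← hsupp c hc.2, ← hsupp d hd.2]
      exact congrArg _ hcd
  have h2 := Set.ncard_le_ncard_sdiff_add_ncard K.oddComponents A (Set.toFinite _)
  omega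

/-- If all edges of `L` lie in the range of an embedding of `K`, then the odd components of `L`
include those of `K` and all singletons off the range. -/
lemma ncard_oddComponents_add_le [Finite X] {K : SimpleGraph Y} {L : SimpleGraph X}
    (e : K ↪g L) (he : ∀ x ∉ Set.range e, ∀ y, ¬ L.Adj x y) :
    K.oddComponents.ncard + (Set.range e)ᶜ.ncard ≤ L.oddComponents.ncard := by
  have : Finite Y := Finite.of_injective e e.injective
  have hreach : ∀ y x, L.Reachable (e y) x → ∃ z, e z = x ∧ K.Reachable y z := by
    intro y x hr
    rw [reachable_iff_reflTransGen] at hr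
    induction hr with
    | refl => exact ⟨y, rfl, Reachable.refl _⟩
    | @tail b x _ hyz ih =>
      obtain ⟨z, rfl, hz⟩ := ih
      by_cases hx : ∃ w, e w = x
      · obtain ⟨w, hw⟩ := hx
        refine ⟨w, hw, hz.trans (Adj.reachable ?_)⟩
        rw [← hw] at hyz
        exact e.map_adj_iff.1 hyz
      · exact absurd hyz.symm (he _ hx _)
  have hsupp : ∀ c : K.ConnectedComponent, (c.map e.toHom).supp = e '' c.supp := by
    intro c
    obtain ⟨y, rfl⟩ := c.exists_rep
    ext x
    constructor
    · intro hx
      obtain ⟨z, rfl, hz⟩ := hreach y x (ConnectedComponent.eq.1 hx).symm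
      exact ⟨z, ConnectedComponent.eq.2 hz.symm, rfl⟩
    · rintro ⟨z, hz, rfl⟩
      exact ConnectedComponent.eq.2 ((ConnectedComponent.eq.1 hz).map e.toHom)
  have hsing : ∀ x ∉ Set.range e, (L.connectedComponentMk x).supp = {x} := by
    intro x hx
    ext y
    constructor
    · intro hy
      have hr : L.Reachable x y := (ConnectedComponent.eq.1 hy).symm
      rw [reachable_iff_reflTransGen] at hr
      rcases hr.cases_head with h | ⟨z, hz, -⟩
      · exact h.symm
      · exact absurd hz (he x hx z)
    · rintro rfl
      rfl
  have h1 : ((fun c => c.map e.toHom) '' K.oddComponents).ncard = K.oddComponents.ncard := by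
    refine Set.ncard_image_of_injective _ fun c d hcd => ?_
    apply ConnectedComponent.supp_injective
    apply e.injective.image_injective
    rw [← hsupp, ← hsupp]
    exact congrArg _ hcd
  have h2 : (L.connectedComponentMk '' (Set.range e)ᶜ).ncard = (Set.range e)ᶜ.ncard := by
    refine Set.InjOn.ncard_image fun x hx y hy hxy => ?_
    have := congrArg ConnectedComponent.supp hxy
    rwa [hsing x hx, hsing y hy, Set.singleton_eq_singleton_iff] at this
  rw [← h1, ← h2, ← Set.ncard_union_eq _ (Set.toFinite _) (Set.toFinite _)]
  · apply Set.ncard_le_ncard _ (Set.toFinite _)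
    rintro _ (⟨c, hc, rfl⟩ | ⟨x, hx, rfl⟩)
    · have hc : Odd c.supp.ncard := hc
      change Odd (Set.ncard _)
      rw [hsupp, Set.ncard_image_of_injective _ e.injective]
      exact hc
    · change Odd (Set.ncard _)
      rw [hsing x hx, Set.ncard_singleton]
      exact odd_one
  · rw [Set.disjoint_left]
    rintro _ ⟨c, hc, rfl⟩ ⟨x, hx, hxc⟩
    have h3 : x ∈ (c.map e.toHom).supp := hxc
    rw [hsupp] at h3
    obtain ⟨y, -, rfl⟩ := h3
    exact hx ⟨y, rfl⟩

end Isolate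

section NearPerfectMatching

variable {X : Type*}

/-- A matching missing at most one vertex, given as an involution whose fixed points are the
missed vertices. -/
def IsNearMatching (H : SimpleGraph X) (m : X → X) : Prop :=
  m.Involutive ∧ (∀ x, m x = x ∨ H.Adj x (m x)) ∧ ∀ x y, m x = x → m y = y → x = y

lemma Subgraph.IsPerfectMatching.exists_involutive {H : SimpleGraph X} {M : H.Subgraph}
    (hM : M.IsPerfectMatching) : ∃ p : X → X, p.Involutive ∧ ∀ x, H.Adj x (p x) := by
  choose p hp using fun x => (hM.1 (hM.2 x)).exists
  refine ⟨p, fun x => ?_, fun x => (hp x).adj_sub⟩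
  exact (hM.1 (hM.2 (p x))).unique (hp (p x)) (hp x).symm

/-- The graph `H` with an extra vertex joined to everything. -/
def addUniversal (H : SimpleGraph X) : SimpleGraph (Option X) where
  Adj x y := x ≠ y ∧ ∀ a ∈ x, ∀ b ∈ y, H.Adj a b
  symm := ⟨fun _ _ h => ⟨h.1.symm, fun a ha b hb => (h.2 b hb a ha).symm⟩⟩
  loopless := ⟨fun _ h => h.1 rfl⟩

lemma exists_isNearMatching_of_addUniversal {H : SimpleGraph X} {M : H.addUniversal.Subgraph}
    (hM : M.IsPerfectMatching) : ∃ m, H.IsNearMatching m := by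
  obtain ⟨p, hp, hadj⟩ := hM.exists_involutive
  have hm : ∀ x y, p (some x) = some y → ((p (some x)).getD x) = y := by
    intro x y h
    rw [h]
    rfl
  have hfix : ∀ x, (p (some x)).getD x = x → p none = some x := by
    intro x hx
    cases h : p (some x) with
    | none => rw [← h, hp]
    | some y =>
      rw [hm x y h] at hx
      subst hx
      exact absurd h (hadj (some y)).1.symm
  refine ⟨fun x => (p (some x)).getD x, fun x => ?_, fun x => ?_, fun x y hx hy => ?_⟩ <;>
    dsimp only at *
  · cases h : p (some x) with
    | none => simp [h]
    | some y =>
      have : p (some y) = some x := by rw [← h, hp]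
      simp [this]
  · cases h : p (some x) with
    | none => simp
    | some y =>
      have := (hadj (some x)).2 x rfl y h
      simpa [h] using Or.inr this
  · have := (hfix x hx).symm.trans (hfix y hy)
    simpa using this

lemma deleteVerts_top_coe_adj {H : SimpleGraph X} {u : Set X}
    (x y : ((⊤ : H.Subgraph).deleteVerts u).verts) :
    ((⊤ : H.Subgraph).deleteVerts u).coe.Adj x y ↔ H.Adj x.1 y.1 := by
  have hx := x.2
  have hy := y.2
  simp only [Subgraph.deleteVerts_verts, Subgraph.verts_top, Set.mem_sdiff] at hx hy
  simp [hx, hy]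

/-- Tutte's condition with deficiency one, phrased with `isolate`, in which every vertex of `U`
is itself an odd component. -/
theorem exists_isNearMatching [Finite X] (H : SimpleGraph X)
    (h : ∀ U : Set X, (H.isolate U).oddComponents.ncard ≤ 2 * U.ncard + 1) :
    ∃ m, H.IsNearMatching m := by
  rcases Nat.even_or_odd (Nat.card X) with hX | hX
  · obtain ⟨M, hM⟩ : ∃ M : H.Subgraph, M.IsPerfectMatching := by
      rw [tutte]
      intro u hu
      let e : ((⊤ : H.Subgraph).deleteVerts u).coe ↪g H.isolate u :=
        { toFun := fun x => x.1
          inj' := Subtype.val_injective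
          map_rel_iff' := by
            rintro ⟨x, hx⟩ ⟨y, hy⟩
            simp at hx hy
            simp [isolate, hx, hy] }
      have hr : Set.range e = uᶜ := by
        ext x
        simp [e]
      have h1 := ncard_oddComponents_add_le e (by
        rw [hr]
        intro x hx y hxy
        exact hx hxy.2.1)
      rw [hr, compl_compl] at h1
      have h2 : ¬ Odd (H.isolate u).oddComponents.ncard := by
        rw [odd_ncard_oddComponents, Nat.not_odd_iff_even]
        exact hX
      have h3 := h u
      unfold IsTutteViolator at hu
      grind
    obtain ⟨p, hp, hadj⟩ := hM.exists_involutive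
    exact ⟨p, hp, fun x => Or.inr (hadj x), fun x y hx => absurd hx (hadj x).ne'⟩
  · obtain ⟨M, hM⟩ : ∃ M : H.addUniversal.Subgraph, M.IsPerfectMatching := by
      rw [tutte]
      intro u hu
      unfold IsTutteViolator at hu
      by_cases hn : none ∈ u
      · have hsome : ∀ x : ((⊤ : H.addUniversal.Subgraph).deleteVerts u).verts,
            ∃ y, some y = x.1 := by
          rintro ⟨x, hx⟩
          cases x with
          | none => simp [hn] at hx
          | some y => exact ⟨y, rfl⟩
        choose f hf using hsome
        have hfu : ∀ x, f x ∉ some ⁻¹' u := by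
          intro x hx
          have := x.2
          simp only [Set.mem_preimage, hf] at hx
          simp [hx] at this
        let e : ((⊤ : H.addUniversal.Subgraph).deleteVerts u).coe ↪g H.isolate (some ⁻¹' u) :=
          { toFun := f
            inj' := fun x y hxy => Subtype.ext (by rw [← hf, ← hf, hxy])
            map_rel_iff' := by
              intro x y
              have h2 := hfu x
              have h3 := hfu y
              have h1 : H.addUniversal.Adj x.1 y.1 ↔ H.Adj (f x) (f y) := by
                rw [← hf x, ← hf y]
                simp only [addUniversal, Option.mem_def, Option.some.injEq, forall_eq', ne_eq,
                  and_iff_right_iff_imp]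
                exact fun h => h.ne
              rw [deleteVerts_top_coe_adj, h1]
              change (H.Adj (f x) (f y) ∧ _ ∧ _) ↔ _
              tauto }
        have hr : Set.range e = (some ⁻¹' u)ᶜ := by
          ext x
          constructor
          · rintro ⟨y, rfl⟩
            exact hfu y
          · intro hx
            refine ⟨⟨some x, by simpa using hx⟩, ?_⟩
            exact Option.some_injective _ (hf _)
        have h1 := ncard_oddComponents_add_le e (by
          rw [hr]
          intro x hx y hxy
          exact hx hxy.2.1)
        rw [hr, compl_compl] at h1
        have h2 : u = insert none (some '' (some ⁻¹' u)) := by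
          ext x
          cases x <;> simp [hn]
        have h3 : u.ncard = (some ⁻¹' u).ncard + 1 := by
          conv_lhs => rw [h2]
          rw [Set.ncard_insert_of_notMem (by simp) (Set.toFinite _),
            Set.ncard_image_of_injective _ (Option.some_injective _)]
        have h4 := h (some ⁻¹' u)
        omega
      · have hsub : ∀ c : ((⊤ : H.addUniversal.Subgraph).deleteVerts u).coe.ConnectedComponent,
            c = connectedComponentMk _ ⟨none, by simpa using hn⟩ := by
          intro c
          obtain ⟨x, rfl⟩ := c.exists_rep
          by_cases hx : x = ⟨none, by simpa using hn⟩
          · rw [hx]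
            rfl
          · refine ConnectedComponent.eq.2 (Adj.reachable ?_)
            have h2 : x.1 ≠ none := fun h => hx (Subtype.ext h)
            rw [deleteVerts_top_coe_adj]
            exact ⟨h2, by simp⟩
        have h1 : ((⊤ : H.addUniversal.Subgraph).deleteVerts u).coe.oddComponents.ncard ≤ 1 :=
          (Set.ncard_le_one_iff (Set.toFinite _)).2 fun {_ _} _ _ => (hsub _).trans (hsub _).symm
        have h2 : u = ∅ := (Set.ncard_eq_zero (Set.toFinite _)).1 (by omega)
        subst h2
        have h3 : Odd ((⊤ : H.addUniversal.Subgraph).deleteVerts ∅).coe.oddComponents.ncard := by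
          have : ((⊤ : H.addUniversal.Subgraph).deleteVerts ∅).coe.oddComponents.ncard = 1 := by
            rw [Set.ncard_empty] at hu
            omega
          rw [this]
          exact odd_one
        rw [odd_ncard_oddComponents] at h3
        simp [Set.ncard_univ] at h3
        grind
    exact exists_isNearMatching_of_addUniversal hM

end NearPerfectMatching

end SimpleGraph

namespace SimpleGraph

section FactorGadget

variable {V : Type*}

/-- The graph whose perfect matchings correspond to the `r`-factors of `G`: it has `r` copies of
each vertex of `G`, and every edge is subdivided into two adjacent darts, each joined to all
copies of its source. -/
def factorGadget (G : SimpleGraph V) (r : ℕ) : SimpleGraph ((V × Fin r) ⊕ G.Dart) where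
  Adj
    | .inl a, .inr d => d.fst = a.1
    | .inr d, .inl a => d.fst = a.1
    | .inr d, .inr d' => d' = d.symm
    | .inl _, .inl _ => False
  symm := ⟨by
    rintro (a | d) (b | d') h
    · exact h
    · exact h
    · exact h
    · have h : d' = d.symm := h
      exact (Dart.symm_symm d ▸ congrArg Dart.symm h).symm⟩
  loopless := ⟨by
    rintro (a | d) h
    · exact h
    · exact d.symm_ne h.symm⟩

/-- The spanning subgraph of `G` formed by the edges whose two darts are not matched to each
other. -/
def factorOfMatching (G : SimpleGraph V) {r : ℕ}
    (m : (V × Fin r) ⊕ G.Dart → (V × Fin r) ⊕ G.Dart) (hm : m.Involutive) : SimpleGraph V where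
  Adj u v := ∃ h : G.Adj u v, m (.inr ⟨(u, v), h⟩) ≠ .inr ⟨(v, u), h.symm⟩
  symm := ⟨fun u v ⟨h, h'⟩ => ⟨h.symm, fun hvu => h' (by rw [← hvu, hm])⟩⟩
  loopless := ⟨fun _ h => G.irrefl h.1⟩

lemma ncard_neighborSet_factorOfMatching [Finite V] {G : SimpleGraph V} {r : ℕ}
    {m : (V × Fin r) ⊕ G.Dart → (V × Fin r) ⊕ G.Dart} (hm : (G.factorGadget r).IsNearMatching m)
    (u : V) :
    ((G.factorOfMatching m hm.1).neighborSet u).ncard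
        + {i : Fin r | m (.inl (u, i)) = .inl (u, i)}.ncard
      = r + {d : G.Dart | d.fst = u ∧ m (.inr d) = .inr d}.ncard := by
  have : Finite G.Dart := Finite.of_injective _ Dart.toProd_injective
  set D : Set G.Dart := {d | d.fst = u ∧ m (.inr d) ≠ .inr d.symm} with hD
  set D' : Set G.Dart := {d | d.fst = u ∧ m (.inr d) = .inr d} with hD'
  have h1 : ((G.factorOfMatching m hm.1).neighborSet u).ncard = D.ncard := by
    rw [← Set.InjOn.ncard_image (f := fun d : G.Dart => d.snd) (s := D)]
    · congr 1
      ext v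
      constructor
      · rintro ⟨h, h'⟩
        exact ⟨⟨(u, v), h⟩, ⟨rfl, h'⟩, rfl⟩
      · rintro ⟨⟨⟨a, b⟩, h⟩, ⟨rfl, h'⟩, rfl⟩
        exact ⟨h, h'⟩
    · rintro ⟨⟨a, b⟩, h⟩ ⟨rfl, -⟩ ⟨⟨a', b'⟩, h'⟩ ⟨h3, -⟩ h4
      ext
      · exact h3.symm
      · exact h4
  have h2 : (D \ D').ncard + D'.ncard = D.ncard := by
    refine Set.ncard_sdiff_add_ncard_of_subset ?_ (Set.toFinite _)
    rintro d ⟨hd, hd'⟩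
    refine ⟨hd, fun h => d.symm_ne ?_⟩
    rw [hd'] at h
    exact (Sum.inr_injective h).symm
  have h3 : (m '' (.inr '' (D \ D'))).ncard = (D \ D').ncard := by
    rw [Set.ncard_image_of_injective _ hm.1.injective,
      Set.ncard_image_of_injective _ Sum.inr_injective]
  have h4 : m '' (.inr '' (D \ D')) =
      (fun i : Fin r => .inl (u, i)) '' {i : Fin r | m (.inl (u, i)) = .inl (u, i)}ᶜ := by
    ext x
    constructor
    · rintro ⟨_, ⟨d, ⟨hd, hd'⟩, rfl⟩, rfl⟩
      have h5 : m (.inr d) ≠ .inr d := fun h => hd' ⟨hd.1, h⟩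
      have h6 := (hm.2.1 (.inr d)).resolve_left h5
      cases h7 : m (.inr d) with
      | inl a =>
        rw [h7] at h6
        have h8 : d.fst = a.1 := h6
        have h9 : a = (u, a.2) := Prod.ext (by rw [← h8, hd.1]) rfl
        refine ⟨a.2, fun h => ?_, (congrArg Sum.inl h9).symm⟩
        have h : m (.inl (u, a.2)) = .inl (u, a.2) := h
        rw [← h9, ← h7, hm.1] at h
        exact h5 h.symm
      | inr d' =>
        rw [h7] at h6
        have h8 : d' = d.symm := h6
        exact absurd (h8 ▸ h7) hd.2
    · rintro ⟨i, hi, rfl⟩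
      have h5 : m (.inl (u, i)) ≠ .inl (u, i) := hi
      have h6 := (hm.2.1 (.inl (u, i))).resolve_left h5
      cases h7 : m (.inl (u, i)) with
      | inl a =>
        rw [h7] at h6
        exact h6.elim
      | inr d =>
        rw [h7] at h6
        have h8 : d.fst = u := h6
        have h9 : m (.inr d) = .inl (u, i) := by rw [← h7, hm.1]
        refine ⟨.inr d, ⟨d, ⟨⟨h8, ?_⟩, fun h => ?_⟩, rfl⟩, h9⟩
        · rw [h9]
          exact Sum.inl_ne_inr
        · have := h.2
          rw [h9] at this
          exact Sum.inl_ne_inr this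
  have h5 := Set.ncard_add_ncard_compl {i : Fin r | m (.inl (u, i)) = .inl (u, i)}
  rw [Nat.card_fin] at h5
  rw [h4, Set.ncard_image_of_injective _ (fun i j h => by simpa using h)] at h3
  omega

lemma hasNearRegularFactor_of_ncard [Fintype V] {G F : SimpleGraph V} {r : ℕ} (hF : F ≤ G)
    (u : V) (hu : (F.neighborSet u).ncard = r ∨ (F.neighborSet u).ncard = r + 1)
    (h : ∀ v ≠ u, (F.neighborSet v).ncard = r) : G.HasNearRegularFactor r := by
  have hd : ∀ v, F.degree v = (F.neighborSet v).ncard := by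
    intro v
    rw [Set.ncard_eq_toFinset_card', Set.toFinset_card]
    exact (card_neighborSet_eq_degree _ _).symm
  have key : ∀ v, F.degree v = r + 1 → v = u := by
    intro v hv
    by_contra hne
    rw [hd, h v hne] at hv
    omega
  refine ⟨F, hF, fun v => ?_, fun v w hv hw => (key v hv).trans (key w hw).symm⟩
  rw [hd]
  by_cases hv : v = u
  · rwa [hv]
  · exact Or.inl (h v hv)

lemma hasNearRegularFactor_of_deficient [Fintype V] {G F : SimpleGraph V} {r : ℕ} (hF : F ≤ G)
    (u : V) (hu : (F.neighborSet u).ncard + 1 = r)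
    (h : ∀ v ≠ u, (F.neighborSet v).ncard = r) (hG : r ≤ (G.neighborSet u).ncard) :
    G.HasNearRegularFactor r := by
  obtain ⟨v, hv, hv'⟩ := Set.exists_mem_notMem_of_ncard_lt_ncard
    (show (F.neighborSet u).ncard < (G.neighborSet u).ncard by omega)
  have hGuv : G.Adj u v := hv
  have hFuv : ¬ F.Adj u v := hv'
  have hne : u ≠ v := hGuv.ne
  have hN : ∀ x, (F ⊔ edge u v).neighborSet x =
      F.neighborSet x ∪ {y | (x = u ∧ y = v) ∨ (x = v ∧ y = u)} := by
    intro x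
    ext y
    simp only [mem_neighborSet, sup_adj, edge_adj, Set.mem_union, Set.mem_ofPred_eq]
    constructor
    · rintro (h | h)
      · exact Or.inl h
      · exact Or.inr (by tauto)
    · rintro (h | ⟨rfl, rfl⟩ | ⟨rfl, rfl⟩)
      · exact Or.inl h
      · exact Or.inr (by tauto)
      · exact Or.inr ⟨by tauto, hne.symm⟩
  have hins : ∀ x y, ¬ F.Adj x y → (F.neighborSet x ∪ {y}).ncard = (F.neighborSet x).ncard + 1 := by
    intro x y hxy
    rw [Set.union_singleton, Set.ncard_insert_of_notMem (show y ∉ F.neighborSet x from hxy) (Set.toFinite _)]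
  refine hasNearRegularFactor_of_ncard (F := F ⊔ edge u v) (sup_le hF ?_) v ?_ ?_
  · rw [edge_le_iff]
    exact Or.inr hGuv
  · right
    rw [hN, show {y | (v = u ∧ y = v) ∨ (v = v ∧ y = u)} = {u} by ext; simp [hne.symm],
      hins v u (fun h => hFuv h.symm), h v hne.symm]
  · intro x hx
    rw [hN]
    by_cases hxu : x = u
    · subst hxu
      rw [show {y | (x = x ∧ y = v) ∨ (x = v ∧ y = x)} = {v} by ext; simp [hne], hins _ _ hFuv, hu]
    · rw [show {y | (x = u ∧ y = v) ∨ (x = v ∧ y = u)} = ∅ by ext; simp [hx, hxu], Set.union_empty,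
        h x hxu]

theorem hasNearRegularFactor_of_isNearMatching [Fintype V] {G : SimpleGraph V} {r : ℕ}
    {m : (V × Fin r) ⊕ G.Dart → (V × Fin r) ⊕ G.Dart} (hm : (G.factorGadget r).IsNearMatching m)
    (hG : ∀ u, r ≤ (G.neighborSet u).ncard) : G.HasNearRegularFactor r := by
  have : Finite G.Dart := Finite.of_injective _ Dart.toProd_injective
  have hle : G.factorOfMatching m hm.1 ≤ G := fun _ _ h => h.1
  have hcount := ncard_neighborSet_factorOfMatching hm
  have hP : ∀ u, (∀ i, m (.inl (u, i)) ≠ .inl (u, i)) →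
      {i : Fin r | m (.inl (u, i)) = .inl (u, i)}.ncard = 0 := by
    intro u h
    rw [Set.ncard_eq_zero (Set.toFinite _)]
    exact Set.eq_empty_iff_forall_notMem.2 h
  have hQ : ∀ u, (∀ d : G.Dart, d.fst = u → m (.inr d) ≠ .inr d) →
      {d : G.Dart | d.fst = u ∧ m (.inr d) = .inr d}.ncard = 0 := by
    intro u h
    rw [Set.ncard_eq_zero (Set.toFinite _)]
    exact Set.eq_empty_iff_forall_notMem.2 fun d hd => h d hd.1 hd.2
  by_cases hfix : ∃ x, m x = x
  · obtain ⟨x, hx⟩ := hfix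
    have huniq : ∀ y, m y = y → y = x := fun y hy => hm.2.2 y x hy hx
    rcases x with ⟨u, i⟩ | d
    · have hQ0 : ∀ v, {d : G.Dart | d.fst = v ∧ m (.inr d) = .inr d}.ncard = 0 := fun v =>
        hQ v fun d _ h => Sum.inr_ne_inl (huniq _ h)
      refine hasNearRegularFactor_of_deficient hle u ?_ ?_ (hG u)
      · have h1 : {i : Fin r | m (.inl (u, i)) = .inl (u, i)} = {i} := by
          ext j
          constructor
          · intro hj
            have := huniq _ hj
            simpa using this
          · rintro rfl
            exact hx
        have h2 := hcount u
        rw [h1, Set.ncard_singleton, hQ0] at h2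
        exact h2
      · intro v hv
        have h2 := hcount v
        rw [hQ0, hP v fun j hj => hv ?_] at h2
        · exact h2
        · have := huniq _ hj
          simp only [Sum.inl.injEq, Prod.mk.injEq] at this
          exact this.1
    · have hP0 : ∀ v, {i : Fin r | m (.inl (v, i)) = .inl (v, i)}.ncard = 0 := fun v =>
        hP v fun i h => Sum.inl_ne_inr (huniq _ h)
      refine hasNearRegularFactor_of_ncard hle d.fst (Or.inr ?_) ?_
      · have h1 : {d' : G.Dart | d'.fst = d.fst ∧ m (.inr d') = .inr d'} = {d} := by
          ext d'
          constructor
          · rintro ⟨-, h⟩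
            exact Sum.inr_injective (huniq _ h)
          · rintro rfl
            exact ⟨rfl, hx⟩
        have h2 := hcount d.fst
        rw [h1, Set.ncard_singleton, hP0] at h2
        exact h2
      · intro v hv
        have h2 := hcount v
        rw [hP0, hQ v fun d' hd' h => hv ?_] at h2
        · exact h2
        · rw [← hd', Sum.inr_injective (huniq _ h)]
  · push Not at hfix
    have h1 : ∀ v, ((G.factorOfMatching m hm.1).neighborSet v).ncard = r := by
      intro v
      have h2 := hcount v
      rwa [hP v fun i => hfix _, hQ v fun d _ => hfix _] at h2
    rcases isEmpty_or_nonempty V with hV | ⟨⟨u⟩⟩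
    · exact ⟨⊥, bot_le, fun v => hV.elim v, fun v => hV.elim v⟩
    · exact hasNearRegularFactor_of_ncard hle u (Or.inl (h1 u)) fun v _ => h1 v

end FactorGadget

end SimpleGraph

namespace SimpleGraph

section Barrier

variable {V X : Type*}

/-- In an inclusion-minimal violator `U` of the deficiency-one Tutte condition, a nonempty
`W ⊆ U` has neighbors in at least `|W| + 2` components off `U`. -/
lemma ncard_add_two_le_of_minimal [Finite X] {H : SimpleGraph X} {U : Set X}
    (hU : Minimal (fun U : Set X => 2 * U.ncard + 1 < (H.isolate U).oddComponents.ncard) U)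
    {W : Set X} (hWU : W ⊆ U) (hW : W.Nonempty) (P : Set X)
    (hP : ∀ w ∈ W, ∀ x ∉ U, H.Adj w x → ∃ p ∈ P, (H.isolate U).Reachable x p) :
    W.ncard + 2 ≤ P.ncard := by
  let K := H.isolate U
  let A : Set K.ConnectedComponent := K.connectedComponentMk '' (W ∪ P)
  have hA : A.ncard ≤ W.ncard + P.ncard :=
    (Set.ncard_image_le (Set.toFinite _)).trans (Set.ncard_union_le _ _)
  have hmono := ncard_oddComponents_le_add (H.isolate_anti (Set.sdiff_subset : U \ W ⊆ U)) A (by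
    intro c hc x hx y hxy
    have hxc : K.connectedComponentMk x = c := hx
    have hxW : x ∉ W := fun h => hc ⟨x, Or.inl h, hxc⟩
    have hxU : x ∉ U := fun h => hxy.2.1 ⟨h, hxW⟩
    have hyU : y ∉ U := by
      intro hy
      have hyW : y ∈ W := by
        by_contra h
        exact hxy.2.2 ⟨hy, h⟩
      obtain ⟨p, hp, hr⟩ := hP y hyW x hxU hxy.1.symm
      exact hc ⟨p, Or.inr hp, (ConnectedComponent.eq.2 hr.symm).trans hxc⟩
    have hadj : K.Adj x y := ⟨hxy.1, hxU, hyU⟩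
    exact (ConnectedComponent.eq.2 hadj.reachable.symm).trans hxc)
  have hlt : (H.isolate (U \ W)).oddComponents.ncard ≤ 2 * (U \ W).ncard + 1 := by
    by_contra! h
    obtain ⟨w, hw⟩ := hW
    exact (hU.2 h Set.sdiff_subset (hWU hw)).2 hw
  have hcard := Set.ncard_sdiff_add_ncard_of_subset hWU (Set.toFinite _)
  have hU1 := hU.1
  have hpar1 := odd_ncard_oddComponents (G := H.isolate U)
  have hpar2 := odd_ncard_oddComponents (G := H.isolate (U \ W))
  grind

lemma ncard_darts_fst_eq (G : SimpleGraph V) (t : V) (p : V → Prop) :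
    {d : G.Dart | d.fst = t ∧ p d.snd}.ncard = {v | G.Adj t v ∧ p v}.ncard := by
  rw [← Set.InjOn.ncard_image (f := fun d : G.Dart => d.snd)]
  · congr 1
    ext v
    constructor
    · rintro ⟨d, ⟨rfl, hd⟩, rfl⟩
      exact ⟨d.adj, hd⟩
    · rintro ⟨h, hp⟩
      exact ⟨⟨(t, v), h⟩, ⟨rfl, hp⟩, rfl⟩
  · rintro d ⟨hd, -⟩ d' ⟨hd', -⟩ h
    ext
    · exact hd.trans hd'.symm
    · exact h

lemma ncard_darts_fst_mem [Finite V] (G : SimpleGraph V) (T : Finset V) (p : V → Prop) :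
    {d : G.Dart | d.fst ∈ T ∧ p d.snd}.ncard = ∑ t ∈ T, {v | G.Adj t v ∧ p v}.ncard := by
  have : Finite G.Dart := Finite.of_injective _ Dart.toProd_injective
  induction T using Finset.induction_on with
  | empty => simp
  | insert t T ht ih =>
    rw [Finset.sum_insert ht, ← ih, ← ncard_darts_fst_eq, ← Set.ncard_union_eq]
    · congr 1
      ext d
      simp only [Finset.mem_insert, Set.mem_ofPred_eq, Set.mem_union]
      tauto
    · rw [Set.disjoint_left]
      rintro d ⟨rfl, -⟩ ⟨h, -⟩
      exact ht h

lemma ncard_darts_symm (G : SimpleGraph V) (p : V → V → Prop) :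
    {d : G.Dart | p d.snd d.fst}.ncard = {d : G.Dart | p d.fst d.snd}.ncard := by
  rw [← Set.ncard_image_of_injective _ Dart.symm_involutive.injective]
  congr 1
  ext d
  constructor
  · rintro ⟨d, hd, rfl⟩
    exact hd
  · intro hd
    exact ⟨d.symm, hd, d.symm_symm⟩

/-- If the factor gadget of `G` has no near-perfect matching, then `G` has a Tutte-type barrier
`(S, T)` in which `T` induces a graph of maximum degree at most `r - 2`. -/
theorem exists_barrier [Finite V] (G : SimpleGraph V) {r : ℕ} (hr : 0 < r)
    (hdeg : ∀ u, ∃ v, G.Adj u v) (h : ¬ ∃ m, (G.factorGadget r).IsNearMatching m) :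
    ∃ S T : Finset V, Disjoint S T ∧
      (∀ t ∈ T, {v | G.Adj t v ∧ v ∈ T}.ncard + 2 ≤ r) ∧
      r * #S + ∑ t ∈ T, {v | G.Adj t v ∧ v ∉ S}.ncard + 2 ≤ r * #T + G.compCount (S ∪ T) := by
  cases nonempty_fintype V
  have : Finite G.Dart := Finite.of_injective _ Dart.toProd_injective
  let H := G.factorGadget r
  obtain ⟨U, hU⟩ : ∃ U, Minimal
      (fun U => 2 * U.ncard + 1 < (H.isolate U).oddComponents.ncard) U := by
    apply exists_minimal_of_wellFoundedLT
    by_contra! h'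
    exact h (H.exists_isNearMatching h')
  let K := H.isolate U
  have copies_all : ∀ u i j, Sum.inl (u, i) ∈ U → Sum.inl (u, j) ∈ U := by
    intro u i j hi
    by_contra hj
    have := ncard_add_two_le_of_minimal hU (Set.singleton_subset_iff.2 hi)
      (Set.singleton_nonempty _) {.inl (u, j)} (by
        rintro _ rfl (a | d) hx hadj
        · exact hadj.elim
        · have : K.Adj (.inr d) (.inl (u, j)) := ⟨hadj, hx, hj⟩
          exact ⟨_, rfl, this.reachable⟩)
    simp only [Set.ncard_singleton] at this
    omega
  have darts_all : ∀ d d' : G.Dart, d.fst = d'.fst → Sum.inr d ∈ U → Sum.inr d' ∈ U := by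
    intro d d' hdd' hd
    by_contra hd'
    have := ncard_add_two_le_of_minimal hU (Set.singleton_subset_iff.2 hd)
      (Set.singleton_nonempty _) {.inr d.symm, .inr d'} (by
        rintro _ rfl (a | e) hx hadj
        · have hda : d.fst = a.1 := hadj
          have : K.Adj (.inl a) (.inr d') := ⟨hdd'.symm.trans hda, hx, hd'⟩
          exact ⟨_, Or.inr rfl, this.reachable⟩
        · have he : e = d.symm := hadj
          exact ⟨_, Or.inl (congrArg _ he), Reachable.refl _⟩)
    have h2 := Set.ncard_insert_le (Sum.inr d.symm : (V × Fin r) ⊕ G.Dart) {.inr d'}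
    simp only [Set.ncard_singleton] at this h2
    omega
  have not_both : ∀ (d : G.Dart) i, Sum.inr d ∈ U → Sum.inl (d.fst, i) ∉ U := by
    intro d i hd hi
    have := ncard_add_two_le_of_minimal hU (Set.singleton_subset_iff.2 hd)
      (Set.singleton_nonempty _) {.inr d.symm} (by
        rintro _ rfl (a | e) hx hadj
        · have hda : d.fst = a.1 := hadj
          refine absurd (copies_all _ i a.2 hi) ?_
          rwa [hda]
        · have he : e = d.symm := hadj
          exact ⟨_, congrArg _ he, Reachable.refl _⟩)
    simp only [Set.ncard_singleton] at this
    omega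
  let S : Finset V := {u | ∃ i, Sum.inl (u, i) ∈ U}
  let T : Finset V := {u | ∃ d : G.Dart, d.fst = u ∧ Sum.inr d ∈ U}
  have memS : ∀ u i, Sum.inl (u, i) ∈ U ↔ u ∈ S := by
    intro u i
    simp only [S, Finset.mem_filter, Finset.mem_univ, true_and]
    exact ⟨fun h => ⟨i, h⟩, fun ⟨j, h⟩ => copies_all u j i h⟩
  have memT : ∀ d : G.Dart, Sum.inr d ∈ U ↔ d.fst ∈ T := by
    intro d
    simp only [T, Finset.mem_filter, Finset.mem_univ, true_and]
    exact ⟨fun h => ⟨d, rfl, h⟩, fun ⟨d', h, h'⟩ => darts_all d' d h h'⟩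
  have hST : Disjoint S T := by
    rw [Finset.disjoint_left]
    intro u huS huT
    simp only [T, Finset.mem_filter, Finset.mem_univ, true_and] at huT
    obtain ⟨d, rfl, hd⟩ := huT
    exact not_both d ⟨0, hr⟩ hd ((memS _ _).2 huS)
  have card_copies : ∀ A : Finset V,
      (Sum.inl '' {a | a.1 ∈ A} : Set ((V × Fin r) ⊕ G.Dart)).ncard = r * #A := by
    intro A
    rw [Set.ncard_image_of_injective _ Sum.inl_injective,
      show {a : V × Fin r | a.1 ∈ A} = (A : Set V) ×ˢ Set.univ by ext; simp, Set.ncard_prod,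
      Set.ncard_univ, Set.ncard_coe_finset, Nat.card_fin, mul_comm]
  refine ⟨S, T, hST, fun t ht => ?_, ?_⟩
  · have hW := ncard_add_two_le_of_minimal hU (W := .inr '' {d : G.Dart | d.fst = t ∧ True})
      (by
        rintro _ ⟨d, ⟨rfl, -⟩, rfl⟩
        exact (memT d).2 ht)
      (by
        obtain ⟨v, hv⟩ := hdeg t
        exact ⟨_, ⟨(t, v), hv⟩, ⟨rfl, trivial⟩, rfl⟩)
      (Sum.inl '' {a | a.1 ∈ ({t} : Finset V)} ∪ .inr '' {d : G.Dart | d.snd = t ∧ d.fst ∉ T})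
      (by
        rintro _ ⟨d, ⟨rfl, -⟩, rfl⟩ (a | e) hx hadj
        · have hda : d.fst = a.1 := hadj
          exact ⟨_, Or.inl ⟨a, by simp [hda], rfl⟩, Reachable.refl _⟩
        · have he : e = d.symm := hadj
          exact ⟨_, Or.inr ⟨e, ⟨by rw [he]; rfl, fun h => hx ((memT e).2 h)⟩, rfl⟩,
            Reachable.refl _⟩)
    have hP := hW.trans (Set.ncard_union_le _ _)
    rw [card_copies, Set.ncard_image_of_injective _ Sum.inr_injective,
      Set.ncard_image_of_injective _ Sum.inr_injective,
      ncard_darts_symm G (fun a b => a = t ∧ b ∉ T), ncard_darts_fst_eq G t (fun _ => True),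
      ncard_darts_fst_eq G t (· ∉ T), Finset.card_singleton] at hP
    have hsplit : {v | G.Adj t v ∧ v ∈ T}.ncard + {v | G.Adj t v ∧ v ∉ T}.ncard
        = {v | G.Adj t v ∧ True}.ncard := by
      rw [← Set.ncard_union_eq]
      · congr 1
        ext v
        simp only [Set.mem_union, Set.mem_ofPred_eq]
        tauto
      · rw [Set.disjoint_left]
        rintro v ⟨-, h1⟩ ⟨-, h2⟩
        exact h2 h1
    omega
  · have copy_reach : ∀ u ∉ S, u ∉ T → ∀ i j, K.Reachable (.inl (u, i)) (.inl (u, j)) := by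
      intro u hS hT i j
      obtain ⟨v, hv⟩ := hdeg u
      have hd : Sum.inr ⟨(u, v), hv⟩ ∉ U := fun h => hT ((memT _).1 h)
      have h1 : ∀ k, K.Adj (.inr ⟨(u, v), hv⟩) (.inl (u, k)) := fun k =>
        ⟨rfl, hd, fun h => hS ((memS _ _).1 h)⟩
      exact (h1 i).symm.reachable.trans (h1 j).reachable
    have reach : ∀ x y : ((↑(S ∪ T) : Set V)ᶜ : Set V),
        (G.induce ((↑(S ∪ T) : Set V)ᶜ)).Reachable x y →
        K.Reachable (.inl (x.1, ⟨0, hr⟩)) (.inl (y.1, ⟨0, hr⟩)) := by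
      intro x y hxy
      rw [reachable_iff_reflTransGen] at hxy
      induction hxy with
      | refl => exact Reachable.refl _
      | @tail y z _ hyz ih =>
        refine ih.trans ?_
        have hy := y.2
        have hz := z.2
        simp only [Finset.coe_union, Set.compl_union, Set.mem_inter_iff, Set.mem_compl_iff,
          Finset.mem_coe] at hy hz
        have hadj : G.Adj y.1 z.1 := hyz
        have hyU : Sum.inr ⟨(y.1, z.1), hadj⟩ ∉ U := fun h => hy.2 ((memT _).1 h)
        have hzU : Sum.inr ⟨(z.1, y.1), hadj.symm⟩ ∉ U := fun h => hz.2 ((memT _).1 h)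
        have h1 : K.Adj (.inl (y.1, ⟨0, hr⟩)) (.inr ⟨(y.1, z.1), hadj⟩) :=
          ⟨rfl, fun h => hy.1 ((memS _ _).1 h), hyU⟩
        have h2 : K.Adj (.inr ⟨(y.1, z.1), hadj⟩) (.inr ⟨(z.1, y.1), hadj.symm⟩) :=
          ⟨rfl, hyU, hzU⟩
        have h3 : K.Adj (.inr ⟨(z.1, y.1), hadj.symm⟩) (.inl (z.1, ⟨0, hr⟩)) :=
          ⟨rfl, hzU, fun h => hz.1 ((memS _ _).1 h)⟩
        exact h1.reachable.trans (h2.reachable.trans h3.reachable)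
    let Φ : (G.induce ((↑(S ∪ T) : Set V)ᶜ)).ConnectedComponent → K.ConnectedComponent :=
      fun c => K.connectedComponentMk (.inl (c.out.1, ⟨0, hr⟩))
    have copy_mem : ∀ u ∉ S, u ∉ T → ∀ i, K.connectedComponentMk (.inl (u, i)) ∈ Set.range Φ := by
      intro u hS hT i
      let x : ((↑(S ∪ T) : Set V)ᶜ : Set V) := ⟨u, by simp [hS, hT]⟩
      refine ⟨connectedComponentMk _ x, ConnectedComponent.eq.2 ?_⟩
      refine (reach _ x ?_).trans (copy_reach u hS hT _ i)
      exact ConnectedComponent.eq.1 (Quot.out_eq _)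
    have dart_mem : ∀ d : G.Dart, d.fst ∉ S → d.fst ∉ T →
        K.connectedComponentMk (.inr d) ∈ Set.range Φ := by
      intro d hS hT
      have h1 : K.Adj (.inl (d.fst, ⟨0, hr⟩)) (.inr d) :=
        ⟨rfl, fun h => hS ((memS _ _).1 h), fun h => hT ((memT _).1 h)⟩
      rw [← ConnectedComponent.eq.2 h1.reachable]
      exact copy_mem _ hS hT _
    have hsub : K.oddComponents ⊆
        K.connectedComponentMk '' (U ∪ Sum.inl '' {a | a.1 ∈ T} ∪
          .inr '' {d : G.Dart | d.snd ∈ T ∧ d.fst ∈ S}) ∪ Set.range Φ := by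
      intro c hc
      obtain ⟨x, rfl⟩ := c.exists_rep
      by_cases hxU : x ∈ U
      · exact Or.inl ⟨x, Or.inl (Or.inl hxU), rfl⟩
      rcases x with ⟨u, i⟩ | d
      · have huS : u ∉ S := fun h => hxU ((memS _ _).2 h)
        by_cases huT : u ∈ T
        · exact Or.inl ⟨_, Or.inl (Or.inr ⟨(u, i), huT, rfl⟩), rfl⟩
        · exact Or.inr (copy_mem u huS huT i)
      · have hdT : d.fst ∉ T := fun h => hxU ((memT _).2 h)
        by_cases hdS : d.fst ∈ S
        · by_cases hdT' : d.snd ∈ T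
          · exact Or.inl ⟨_, Or.inr ⟨d, ⟨hdT', hdS⟩, rfl⟩, rfl⟩
          have hsymm : Sum.inr d.symm ∉ U := fun h => hdT' ((memT _).1 h)
          have hadj : K.Adj (.inr d) (.inr d.symm) := ⟨rfl, hxU, hsymm⟩
          by_cases hdS' : d.snd ∈ S
          · have hcl : ∀ y, K.Reachable (.inr d) y → y = .inr d ∨ y = .inr d.symm := by
              intro y hy
              rw [reachable_iff_reflTransGen] at hy
              induction hy with
              | refl => exact Or.inl rfl
              | @tail y z _ hyz ih =>
                rcases z with a | e
                · exfalso
                  apply hyz.2.2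
                  rcases ih with rfl | rfl
                  · have h1 : d.fst = a.1 := hyz.1
                    exact (memS _ _).2 (h1 ▸ hdS)
                  · have h1 : d.snd = a.1 := hyz.1
                    exact (memS _ _).2 (h1 ▸ hdS')
                · rcases ih with rfl | rfl
                  · have h1 : e = d.symm := hyz.1
                    exact Or.inr (congrArg _ h1)
                  · have h1 : e = d.symm.symm := hyz.1
                    exact Or.inl (congrArg _ (h1.trans d.symm_symm))
            have hsupp : (K.connectedComponentMk (.inr d)).supp = {.inr d, .inr d.symm} := by
              ext y
              constructor
              · intro hy
                exact hcl y (ConnectedComponent.eq.1 hy).symm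
              · rintro (rfl | rfl)
                · rfl
                · exact ConnectedComponent.eq.2 hadj.reachable.symm
            have hodd : Odd (K.connectedComponentMk (.inr d)).supp.ncard := hc
            rw [hsupp, Set.ncard_pair (fun h => d.symm_ne (Sum.inr_injective h).symm)] at hodd
            exact absurd hodd (by decide)
          · refine Or.inr ?_
            change K.connectedComponentMk (.inr d) ∈ _
            rw [ConnectedComponent.eq.2 hadj.reachable]
            exact dart_mem d.symm hdS' hdT'
        · exact Or.inr (dart_mem d hdS hdT)
    have hodd : K.oddComponents.ncard ≤ U.ncard + r * #T +
        {d : G.Dart | d.fst ∈ T ∧ d.snd ∈ S}.ncard + G.compCount (S ∪ T) := by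
      refine (Set.ncard_le_ncard hsub (Set.toFinite _)).trans
        ((Set.ncard_union_le _ _).trans (add_le_add ?_ ?_))
      · refine (Set.ncard_image_le (Set.toFinite _)).trans
          ((Set.ncard_union_le _ _).trans (add_le_add ((Set.ncard_union_le _ _).trans ?_) ?_))
        · rw [card_copies]
        · rw [Set.ncard_image_of_injective _ Sum.inr_injective,
            ncard_darts_symm G (fun a b => a ∈ T ∧ b ∈ S)]
      · rw [← Set.image_univ]
        refine (Set.ncard_image_le (Set.toFinite _)).trans ?_
        rw [Set.ncard_univ]
        rfl
    have hUcard : r * #S + {d : G.Dart | d.fst ∈ T ∧ True}.ncard ≤ U.ncard := by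
      rw [← card_copies, ← Set.ncard_image_of_injective {d : G.Dart | d.fst ∈ T ∧ True}
        (Sum.inr_injective (α := V × Fin r)), ← Set.ncard_union_eq]
      · apply Set.ncard_le_ncard _ (Set.toFinite _)
        rintro _ (⟨a, ha, rfl⟩ | ⟨d, hd, rfl⟩)
        · exact (memS _ _).2 ha
        · exact (memT _).2 hd.1
      · rw [Set.disjoint_left]
        rintro _ ⟨a, -, rfl⟩ ⟨d, -, h⟩
        exact Sum.inr_ne_inl h
    have hsplit : {d : G.Dart | d.fst ∈ T ∧ d.snd ∈ S}.ncard
        + {d : G.Dart | d.fst ∈ T ∧ d.snd ∉ S}.ncard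
        = {d : G.Dart | d.fst ∈ T ∧ True}.ncard := by
      rw [← Set.ncard_union_eq]
      · congr 1
        ext v
        simp only [Set.mem_union, Set.mem_ofPred_eq]
        tauto
      · rw [Set.disjoint_left]
        rintro v ⟨-, h1⟩ ⟨-, h2⟩
        exact h2 h1
    rw [ncard_darts_fst_mem G T (· ∉ S)] at hsplit
    have hU1 : 2 * U.ncard + 1 < K.oddComponents.ncard := hU.1
    omega

end Barrier

end SimpleGraph

namespace SimpleGraph

section Toughness

variable {V : Type*}

/-- Greedy choice of an independent set carrying at least a `1 / b` fraction of the total weight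
of a set inducing a graph of maximum degree less than `b`. -/
lemma exists_independent_weight [Finite V] (G : SimpleGraph V) (w : V → ℝ) (b : ℕ)
    (T : Finset V) (hw : ∀ t ∈ T, 0 ≤ w t)
    (hdeg : ∀ t ∈ T, {v | G.Adj t v ∧ v ∈ T}.ncard + 1 ≤ b) :
    ∃ I ⊆ T, (∀ x ∈ I, ∀ y ∈ I, ¬ G.Adj x y) ∧ ∑ t ∈ T, w t ≤ b * ∑ t ∈ I, w t := by
  induction T using Finset.strongInduction with
  | H T ih =>
    rcases T.eq_empty_or_nonempty with rfl | hT
    · exact ⟨∅, by simp⟩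
    obtain ⟨x, hx, hmax⟩ := T.exists_max_image w hT
    have hsub : {y ∈ T | ¬ (y = x ∨ G.Adj x y)} ⊆ T := Finset.filter_subset _ _
    obtain ⟨I, hI, hind, hsum⟩ := ih {y ∈ T | ¬ (y = x ∨ G.Adj x y)}
      (Finset.ssubset_iff_subset_ne.2 ⟨hsub, fun h => by
        rw [← h] at hx
        simp at hx⟩)
      (fun t ht => hw t (hsub ht))
      (fun t ht => le_trans (Nat.add_le_add_right (Set.ncard_le_ncard
        (Set.ofPred_subset_ofPred.2 fun v hv => ⟨hv.1, hsub hv.2⟩) (Set.toFinite _)) 1) (hdeg t (hsub ht)))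
    have hIx : ∀ y ∈ I, y ≠ x ∧ ¬ G.Adj x y := by
      intro y hy
      have := (Finset.mem_filter.1 (hI hy)).2
      tauto
    have hxI : x ∉ I := fun h => (hIx x h).1 rfl
    refine ⟨insert x I, ?_, ?_, ?_⟩
    · exact Finset.insert_subset hx (hI.trans hsub)
    · intro y hy z hz hyz
      rcases Finset.mem_insert.1 hy with rfl | hyI <;>
        rcases Finset.mem_insert.1 hz with rfl | hzI
      · exact G.irrefl hyz
      · exact (hIx z hzI).2 hyz
      · exact (hIx y hyI).2 hyz.symm
      · exact hind y hyI z hzI hyz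
    · have hcard : #{y ∈ T | y = x ∨ G.Adj x y} ≤ b := by
        refine le_trans ?_ (hdeg x hx)
        rw [← Set.ncard_coe_finset]
        refine le_trans (Set.ncard_le_ncard ?_ (Set.toFinite _))
          (Set.ncard_insert_le x {v | G.Adj x v ∧ v ∈ T})
        intro y hy
        obtain ⟨hyT, rfl | hxy⟩ := Finset.mem_filter.1 (Finset.mem_coe.1 hy)
        · exact Or.inl rfl
        · exact Or.inr ⟨hxy, hyT⟩
      have hstar : ∑ y ∈ T with (y = x ∨ G.Adj x y), w y ≤ b * w x := by
        refine (Finset.sum_le_card_nsmul _ _ (w x)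
          fun y hy => hmax y (Finset.mem_filter.1 hy).1).trans ?_
        rw [nsmul_eq_mul]
        exact mul_le_mul_of_nonneg_right (by exact_mod_cast hcard) (hw x hx)
      rw [Finset.sum_insert hxI, mul_add,
        ← Finset.sum_filter_add_sum_filter_not T (fun y => y = x ∨ G.Adj x y)]
      exact add_le_add hstar hsum

lemma sum_sub_le_of_isoCount_le [Finite V] {G : SimpleGraph V} {k : ℝ} (hk : 0 < k)
    (hiso : ∀ S : Finset V, (G.isoCount S : ℝ) ≤ #S / k) (S I : Finset V) (hSI : Disjoint S I)
    (hI : ∀ x ∈ I, ∀ y ∈ I, ¬ G.Adj x y) :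
    ∑ t ∈ I, (k - {v | G.Adj t v ∧ v ∉ S}.ncard) ≤ (#S : ℝ) := by
  cases nonempty_fintype V
  let N : V → Finset V := fun t => {v | G.Adj t v ∧ v ∉ S}
  have hN : ∀ t, {v | G.Adj t v ∧ v ∉ S}.ncard = #(N t) := by
    intro t
    rw [← Set.ncard_coe_finset]
    congr 1
    ext v
    simp [N]
  have hcard : #(S ∪ I.biUnion N) ≤ #S + ∑ t ∈ I, #(N t) :=
    (Finset.card_union_le _ _).trans (Nat.add_le_add_left Finset.card_biUnion_le _)
  have hle : #I ≤ G.isoCount (S ∪ I.biUnion N) := by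
    rw [← Set.ncard_coe_finset]
    apply Set.ncard_le_ncard _ (Set.toFinite _)
    intro t ht
    have ht : t ∈ I := ht
    refine ⟨?_, fun v hv => ?_⟩
    · rw [Finset.mem_union, Finset.mem_biUnion]
      rintro (h | ⟨s, hs, h⟩)
      · exact Finset.disjoint_left.1 hSI h ht
      · exact hI s hs t ht (Finset.mem_filter.1 h).2.1
    · by_cases hvS : v ∈ S
      · exact Finset.mem_union_left _ hvS
      · exact Finset.mem_union_right _
          (Finset.mem_biUnion.2 ⟨t, ht, Finset.mem_filter.2 ⟨Finset.mem_univ _, hv, hvS⟩⟩)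
  have h1 := hiso (S ∪ I.biUnion N)
  rw [le_div_iff₀ hk] at h1
  have h2 : (#I : ℝ) ≤ G.isoCount (S ∪ I.biUnion N) := by exact_mod_cast hle
  have h3 : (#(S ∪ I.biUnion N) : ℝ) ≤ #S + ∑ t ∈ I, (#(N t) : ℝ) := by exact_mod_cast hcard
  have h4 : (#I : ℝ) * k ≤ G.isoCount (S ∪ I.biUnion N) * k :=
    mul_le_mul_of_nonneg_right h2 hk.le
  simp only [hN, Finset.sum_sub_distrib, Finset.sum_const, nsmul_eq_mul]
  linarith

lemma le_ncard_neighborSet_of_isoCount_le [Finite V] {G : SimpleGraph V} {k : ℝ} (hk : 0 < k)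
    (hiso : ∀ S : Finset V, (G.isoCount S : ℝ) ≤ #S / k) (u : V) :
    k ≤ (G.neighborSet u).ncard := by
  have := sum_sub_le_of_isoCount_le hk hiso ∅ {u} (Finset.disjoint_empty_left _) (by simp)
  simp only [Finset.notMem_empty, not_false_eq_true, and_true, Finset.sum_singleton,
    Finset.card_empty, Nat.cast_zero] at this
  exact sub_nonpos.1 this

end Toughness

end SimpleGraph

/-- if `G` is `(r + 1/n)`-iso-tough and `ω(G−S) < |S|/n + 2` for all `S`,
then `G` has a near `r`-factor. -/
theorem near_r_factor_of_iso_tough {V : Type*} [Fintype V] (G : SimpleGraph V)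
    (r : ℕ) (hr : 0 < r) (n : ℝ) (hn : 1 ≤ n)
    (hiso : ∀ S : Finset V, (G.isoCount S : ℝ) ≤ (S.card : ℝ) / (r + 1 / n))
    (hcomp : ∀ S : Finset V, (G.compCount S : ℝ) < (S.card : ℝ) / n + 2) :
    G.HasNearRegularFactor r := by
  have hn0 : 0 < n := by linarith
  have hninv : 0 < 1 / n := by positivity
  have hninv1 : 1 / n ≤ 1 := (div_le_one hn0).2 hn
  have hk : (0 : ℝ) < r + 1 / n := by positivity
  have hdeg : ∀ u, r ≤ (G.neighborSet u).ncard := by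
    intro u
    have := SimpleGraph.le_ncard_neighborSet_of_isoCount_le hk hiso u
    have h : (r : ℝ) ≤ (G.neighborSet u).ncard := by linarith
    exact_mod_cast h
  have hnbr : ∀ u, ∃ v, G.Adj u v := fun u =>
    Set.nonempty_of_ncard_ne_zero (s := G.neighborSet u) (by have := hdeg u; omega)
  by_contra hG
  obtain ⟨S, T, hST, hT, hbar⟩ := G.exists_barrier hr hnbr
    fun ⟨m, hm⟩ => hG (SimpleGraph.hasNearRegularFactor_of_isNearMatching hm hdeg)
  set d : V → ℕ := fun t => {v | G.Adj t v ∧ v ∉ S}.ncard with hd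
  have hc := hcomp (S ∪ T)
  rw [Finset.card_union_of_disjoint hST] at hc
  have hbar' : (r : ℝ) * #S + ∑ t ∈ T, (d t : ℝ) + 2 ≤ r * #T + G.compCount (S ∪ T) := by
    exact_mod_cast hbar
  have hlow : ∑ t ∈ T, ((r + 1 / n : ℝ) - d t) ≤ (r - 1 / n) * #S := by
    have hfilter : ∑ t ∈ T, ((r + 1 / n : ℝ) - d t) ≤
        ∑ t ∈ T with d t ≤ r, ((r + 1 / n : ℝ) - d t) := by
      rw [← Finset.sum_filter_add_sum_filter_not T (fun t => d t ≤ r)]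
      refine add_le_of_nonpos_right (Finset.sum_nonpos fun t ht => ?_)
      have h1 : r + 1 ≤ d t := by
        have := (Finset.mem_filter.1 ht).2
        omega
      have h2 : (r : ℝ) + 1 ≤ d t := by exact_mod_cast h1
      linarith
    obtain ⟨I, hIT, hind, hsum⟩ := G.exists_independent_weight
      (fun t => (r + 1 / n : ℝ) - d t) (r - 1) {t ∈ T | d t ≤ r}
      (fun t ht => by
        have h2 : (d t : ℝ) ≤ r := by exact_mod_cast (Finset.mem_filter.1 ht).2
        linarith)
      (fun t ht => by
        have h1 := hT t (Finset.mem_filter.1 ht).1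
        have h2 : {v | G.Adj t v ∧ v ∈ ({t ∈ T | d t ≤ r} : Finset V)}.ncard ≤
            {v | G.Adj t v ∧ v ∈ T}.ncard :=
          Set.ncard_le_ncard (fun v hv => ⟨hv.1, Finset.filter_subset _ _ hv.2⟩) (Set.toFinite _)
        omega)
    have hIS := SimpleGraph.sum_sub_le_of_isoCount_le hk hiso S I
      (hST.mono_right (hIT.trans (Finset.filter_subset _ _))) hind
    rw [Nat.cast_sub hr, Nat.cast_one] at hsum
    have hr1 : (1 : ℝ) ≤ r := by exact_mod_cast hr
    calc _ ≤ _ := hfilter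
      _ ≤ _ := hsum
      _ ≤ (r - 1 : ℝ) * #S := mul_le_mul_of_nonneg_left hIS (by linarith)
      _ ≤ _ := mul_le_mul_of_nonneg_right (by linarith) (Nat.cast_nonneg _)
  simp only [Finset.sum_sub_distrib, Finset.sum_const, nsmul_eq_mul] at hlow
  push_cast at hc
  rw [div_eq_mul_one_div] at hc
  linarith
end

section
/- Let G be a graph satisfying: for all S ⊆ V(G), ((m+1)/2)·iso(G−S) + ω(G−S) ≤ |S|/m + 1, where m is a positive integer. Then G admits an m-tree-connected spanning subgraph H (i.e., H has m edge-disjoint spanning trees) with maximum degree at most 2m+1, and moreover for any prescribed vertex u one can ensure d_H(u) ≤ m+1. -/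
open Classical Finset

/-- `H` is `m`-tree-connected: it contains `m` pairwise edge-disjoint spanning trees. -/
def SimpleGraph.IsTreeConnected {V : Type*} (m : ℕ) (H : SimpleGraph V) : Prop :=
  ∃ T : Fin m → SimpleGraph V, (∀ i, T i ≤ H) ∧ (∀ i, (T i).IsTree) ∧
    ∀ i j, i ≠ j → Disjoint ((T i).edgeSet) ((T j).edgeSet)

section PartitionBound

variable {V : Type*} (G : SimpleGraph V)

/-- A weighted Caro–Wei bound for the independence number of the subgraph induced by `Z`. -/
lemma exists_indep_subset (m : ℕ) (Z : Finset V) : ∃ I ⊆ Z, (∀ a ∈ I, ∀ b ∈ I, ¬ G.Adj a b) ∧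
    (2 * m + 2) * #Z ≤ (m + 1) * (m + 2) * #I + ∑ v ∈ Z, #(Z.filter (G.Adj v)) := by
  induction Z using Finset.strongInduction with | H Z ih =>
  rcases Z.eq_empty_or_nonempty with rfl | hZ
  · exact ⟨∅, by simp⟩
  obtain ⟨v, hv, hmin⟩ := exists_min_image Z (fun v => #(Z.filter (G.Adj v))) hZ
  set d := #(Z.filter (G.Adj v)) with hd
  set N := insert v (Z.filter (G.Adj v)) with hN
  have hNZ : N ⊆ Z := insert_subset hv (filter_subset _ _)
  have hNcard : #N = d + 1 := card_insert_of_notMem (by simp)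
  obtain ⟨I, hI, hind, hcard⟩ := ih (Z \ N) (sdiff_ssubset hNZ ⟨v, mem_insert_self _ _⟩)
  have hvI : v ∉ I := fun h => (mem_sdiff.1 (hI h)).2 (mem_insert_self _ _)
  have hvadj : ∀ b ∈ I, ¬ G.Adj v b := fun b hb hvb =>
    (mem_sdiff.1 (hI hb)).2 (mem_insert_of_mem (mem_filter.2 ⟨(mem_sdiff.1 (hI hb)).1, hvb⟩))
  refine ⟨insert v I, insert_subset hv (hI.trans sdiff_subset), ?_, ?_⟩
  · intro a ha b hb
    rcases mem_insert.1 ha with rfl | ha <;> rcases mem_insert.1 hb with rfl | hb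
    · exact G.loopless.irrefl _
    · exact hvadj b hb
    · exact fun h => hvadj a (by assumption) h.symm
    · exact hind a ha b hb
  · rw [card_insert_of_notMem hvI]
    have h1 := sum_sdiff (f := fun w => #(Z.filter (G.Adj w))) hNZ
    have h2 : ∑ w ∈ Z \ N, #((Z \ N).filter (G.Adj w)) ≤ ∑ w ∈ Z \ N, #(Z.filter (G.Adj w)) :=
      sum_le_sum fun w _ => card_le_card (filter_subset_filter _ sdiff_subset)
    have h3 : (d + 1) * d ≤ ∑ w ∈ N, #(Z.filter (G.Adj w)) := by
      rw [← hNcard, ← smul_eq_mul, ← sum_const]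
      exact sum_le_sum fun w hw => hmin w (hNZ hw)
    have h4 : #Z = #(Z \ N) + (d + 1) := by rw [← hNcard, card_sdiff_add_card_eq_card hNZ]
    have h5 : (2 * m + 2) * (d + 1) ≤ (m + 1) * (m + 2) + (d + 1) * d := by
      clear_value d
      rcases le_total d m with h | h
      · obtain ⟨k, rfl⟩ := Nat.exists_eq_add_of_le h
        nlinarith
      · obtain ⟨k, rfl⟩ := Nat.exists_eq_add_of_le h
        nlinarith [Nat.le_mul_self k]
    rw [h4, mul_add, mul_add ((m + 1) * (m + 2)), mul_one]
    omega

lemma sum_card_filter_adj_le {E : Finset (Sym2 V)} {Z : Finset V}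
    (hE : ∀ a ∈ Z, ∀ b ∈ Z, G.Adj a b → s(a, b) ∈ E) :
    ∑ v ∈ Z, #(Z.filter (G.Adj v)) ≤ 2 * #E := by
  have h1 : ∑ v ∈ Z, #(Z.filter (G.Adj v)) = #((Z ×ˢ Z).filter fun p => G.Adj p.1 p.2) := by
    rw [card_filter, sum_product]
    simp only [card_filter]
  rw [h1]
  refine (card_le_mul_card_image_of_maps_to (f := fun p : V × V => s(p.1, p.2)) (t := E) ?_ 2 ?_)
  · rintro ⟨a, b⟩ hab
    simp only [mem_filter, mem_product] at hab
    exact hE a hab.1.1 b hab.1.2 hab.2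
  · intro e _
    induction e with | _ x y =>
    refine (card_le_card (t := {(x, y), (y, x)}) ?_).trans card_le_two
    rintro ⟨a, b⟩ hab
    simpa using (mem_filter.1 hab).2

variable [Fintype V]

lemma card_image_le_compCount {α : Type*} [DecidableEq α] (c : V → α) (S : Finset V)
    (h : ∀ a ∉ S, ∀ b ∉ S, G.Adj a b → c a = c b) : #((Sᶜ).image c) ≤ G.compCount S := by
  set G' := G.induce ((↑S : Set V)ᶜ)
  have hc : ∀ v w : ((↑S : Set V)ᶜ : Set V), ∀ p : G'.Walk v w, p.IsPath → c v = c w := by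
    intro v w p _
    induction p with
    | nil => rfl
    | @cons a b _ hadj p ih => exact (h a a.2 b b.2 hadj).trans (ih (by simp_all))
  let f : G'.ConnectedComponent → α := fun C => C.lift (fun v => c v.1) hc
  have : (Sᶜ).image c ⊆ univ.image f := by
    intro x hx
    obtain ⟨v, hv, rfl⟩ := mem_image.1 hx
    exact mem_image.2 ⟨G'.connectedComponentMk ⟨v, by simpa using hv⟩, mem_univ _, rfl⟩
  rw [SimpleGraph.compCount, Nat.card_eq_fintype_card]
  exact (card_le_card this).trans card_image_le

/-- The bound on `iso(G − S)` and `ω(G − S)` implies a bound for every partition of `G − S`,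
given as the colour classes of `c`. -/
lemma mul_card_image_le (m : ℕ) (hm : 0 < m)
    (hcond : ∀ S : Finset V, ((m + 1 : ℝ) / 2) * (G.isoCount S : ℝ) + (G.compCount S : ℝ)
      ≤ (S.card : ℝ) / m + 1) {α : Type*} [DecidableEq α] (c : V → α) (S : Finset V) :
    m * #((Sᶜ).image c) ≤
      #((G.edgeFinset ∩ (Sᶜ).sym2).filter fun e => ¬ (e.map c).IsDiag) + #S + m := by
  by_contra hbad
  set E : Finset V → Finset (Sym2 V) := fun S =>
    (G.edgeFinset ∩ (Sᶜ).sym2).filter fun e => ¬ (e.map c).IsDiag with hE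
  obtain ⟨S, hS, hmax⟩ := exists_max_image
    (univ.filter fun S : Finset V => #(E S) + #S + m < m * #((Sᶜ).image c)) card
    ⟨S, by simpa using hbad⟩
  simp only [mem_filter, mem_univ, true_and] at hS hmax
  have memE : ∀ a b, s(a, b) ∈ E S ↔ G.Adj a b ∧ a ∉ S ∧ b ∉ S ∧ c a ≠ c b := by
    intro a b
    simp [hE, and_assoc]
  -- vertices sharing their colour have no differently coloured neighbours outside `S`
  have hbig : ∀ v ∉ S, ∀ w ∉ S, w ≠ v → c w = c v → ∀ y ∉ S, G.Adj v y → c v = c y := by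
    intro v hv w hw hwv hcw y hy hvy
    by_contra hcy
    have himg : ((insert v S)ᶜ).image c = (Sᶜ).image c := by
      refine (image_subset_image (compl_subset_compl.2 (subset_insert v S))).antisymm ?_
      intro a ha
      obtain ⟨z, hz, rfl⟩ := mem_image.1 ha
      by_cases hzv : z = v
      · rw [hzv, ← hcw]
        exact mem_image_of_mem _ (by simp [hw, hwv])
      · exact mem_image_of_mem _ (by simpa [hzv] using hz)
    have hlt : #(E (insert v S)) < #(E S) := by
      refine card_lt_card ⟨?_, fun hs => ?_⟩
      · refine filter_subset_filter _ (inter_subset_inter_left (sym2_mono ?_))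
        exact compl_subset_compl.2 (subset_insert v S)
      · have := hs ((memE v y).2 ⟨hvy, hv, hy, hcy⟩)
        simp [hE] at this
    have hins := card_insert_of_notMem hv
    have := hmax (insert v S) (by rw [himg]; omega)
    omega
  set Z := (Sᶜ).filter fun v => ∀ w ∉ S, c w = c v → w = v with hZ
  have memZ : ∀ v, v ∈ Z ↔ v ∉ S ∧ ∀ w ∉ S, c w = c v → w = v := by simp [hZ]
  obtain ⟨I, hIZ, hind, hI⟩ := exists_indep_subset G m Z
  have hsum := sum_card_filter_adj_le G (E := E S) (Z := Z) fun a ha b hb hab => by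
    rw [memZ] at ha hb
    exact (memE a b).2 ⟨hab, ha.1, hb.1, fun h => hab.ne (hb.2 a ha.1 h)⟩
  set B := ((Sᶜ) \ Z).image c with hB
  have hBadj : ∀ v ∉ S, v ∉ Z → ∀ y ∉ S, G.Adj v y → c v = c y := by
    intro v hv hvZ
    rw [memZ] at hvZ
    push Not at hvZ
    obtain ⟨w, hw, hcw, hwv⟩ := hvZ hv
    exact hbig v hv w hw hwv hcw
  have hcZ : ∀ J ⊆ Z, #(J.image c ∪ B) = #J + #B := by
    intro J hJ
    rw [card_union_of_disjoint, card_image_of_injOn]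
    · intro a ha b hb hab
      exact ((memZ b).1 (hJ hb)).2 a ((memZ a).1 (hJ ha)).1 hab
    · rw [disjoint_left]
      intro x hx hx'
      obtain ⟨a, ha, rfl⟩ := mem_image.1 hx
      obtain ⟨b, hb, hab⟩ := mem_image.1 hx'
      simp only [mem_sdiff, mem_compl] at hb
      have := ((memZ a).1 (hJ ha)).2 b hb.1 hab
      exact hb.2 (this ▸ hJ ha)
  set S' := S ∪ (Z \ I) with hS'
  have memS' : ∀ v, v ∉ S' ↔ v ∉ S ∧ (v ∈ Z → v ∈ I) := by
    intro v
    simp only [hS', mem_union, mem_sdiff]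
    tauto
  have himg : (Sᶜ).image c = Z.image c ∪ B := by
    rw [hB, ← image_union, union_sdiff_of_subset (filter_subset _ _)]
  have himg' : (S'ᶜ).image c = I.image c ∪ B := by
    rw [hB, ← image_union]
    congr 1
    ext v
    simp only [mem_compl, memS', mem_union, mem_sdiff]
    have := fun h => ((memZ v).1 (hIZ h)).1
    tauto
  have hIiso : ∀ v ∈ I, ∀ y, G.Adj v y → y ∈ S' := by
    intro v hv y hvy
    by_contra hy
    rw [memS'] at hy
    have hvS := ((memZ v).1 (hIZ hv)).1
    by_cases hyZ : y ∈ Z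
    · exact hind v hv y (hy.2 hyZ) hvy
    · exact hvy.ne.symm (((memZ v).1 (hIZ hv)).2 y hy.1 (hBadj y hy.1 hyZ v hvS hvy.symm))
  have hiso : #I ≤ G.isoCount S' := by
    rw [SimpleGraph.isoCount, ← Set.ncard_coe_finset]
    refine Set.ncard_le_ncard (fun v hv => ?_) (Set.toFinite _)
    exact ⟨(memS' v).2 ⟨((memZ v).1 (hIZ hv)).1, fun _ => hv⟩, hIiso v hv⟩
  have hcomp : #I + #B ≤ G.compCount S' := by
    rw [← hcZ I hIZ, ← himg']
    refine card_image_le_compCount G c S' fun a ha b hb hab => ?_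
    by_cases haI : a ∈ I
    · exact absurd (hIiso a haI b hab) hb
    · exact hBadj a ((memS' a).1 ha).1 (fun h => haI (((memS' a).1 ha).2 h)) b
        ((memS' b).1 hb).1 hab
  have hS'card : #S' + #I = #S + #Z := by
    rw [hS', card_union_of_disjoint, add_assoc, card_sdiff_add_card_eq_card hIZ]
    rw [disjoint_right]
    intro v hv
    exact ((memZ v).1 (mem_sdiff.1 hv).1).1
  rw [himg, hcZ Z subset_rfl] at hS
  have hm' : (0 : ℝ) < m := by exact_mod_cast hm
  have h1 := hcond S'
  have h2 : ((m + 1 : ℝ) / 2) * #I + (#I + #B) ≤ (#S' : ℝ) / m + 1 := by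
    refine le_trans (add_le_add ?_ (by exact_mod_cast hcomp)) h1
    exact mul_le_mul_of_nonneg_left (by exact_mod_cast hiso) (by positivity)
  have h3 : (m : ℝ) * (m + 1) * #I + 2 * m * (#I + #B) ≤ 2 * #S' + 2 * m := by
    have := mul_le_mul_of_nonneg_left h2 (by positivity : (0 : ℝ) ≤ 2 * m)
    field_simp at this
    linarith
  have h4 : m * (m + 1) * #I + 2 * m * (#I + #B) ≤ 2 * #S' + 2 * m := by exact_mod_cast h3
  nlinarith

end PartitionBound

section SparseEdgeSets

variable {V : Type*} {m : ℕ} {H K : Finset (Sym2 V)} {X Y p : Finset V}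

/-- An edge set is `m`-sparse if every nonempty vertex set `X` spans at most `m (|X| - 1)` edges. -/
def IsSparse (m : ℕ) (H : Finset (Sym2 V)) : Prop :=
  ∀ X : Finset V, X.Nonempty → #(H ∩ X.sym2) + m ≤ m * #X

/-- A nonempty vertex set `X` is tight if it spans exactly `m (|X| - 1)` edges. -/
def IsTight (m : ℕ) (H : Finset (Sym2 V)) (X : Finset V) : Prop :=
  X.Nonempty ∧ #(H ∩ X.sym2) + m = m * #X

lemma IsSparse.mono (hK : IsSparse m K) (h : H ⊆ K) : IsSparse m H := fun X hX =>
  (Nat.add_le_add_right (card_le_card (inter_subset_inter_right h)) m).trans (hK X hX)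

lemma IsSparse.isTight_singleton (hH : IsSparse m H) (v : V) : IsTight m H {v} := by
  refine ⟨singleton_nonempty v, ?_⟩
  have := hH {v} (singleton_nonempty v)
  simp only [card_singleton, mul_one] at this ⊢
  omega

lemma IsSparse.not_isDiag (hH : IsSparse m H) {e : Sym2 V} (he : e ∈ H) : ¬ e.IsDiag := by
  induction e with | _ a b =>
  rw [Sym2.mk_isDiag_iff]
  rintro rfl
  have h := (hH.isTight_singleton a).2
  have : 0 < #(H ∩ ({a} : Finset V).sym2) :=
    card_pos.2 ⟨s(a, a), mem_inter.2 ⟨he, mk_mem_sym2_iff.2 (by simp)⟩⟩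
  simp only [card_singleton, mul_one] at h
  omega

lemma card_inter_sym2_add_le (H : Finset (Sym2 V)) (X Y : Finset V) :
    #(H ∩ X.sym2) + #(H ∩ Y.sym2) ≤ #(H ∩ (X ∪ Y).sym2) + #(H ∩ (X ∩ Y).sym2) := by
  rw [← card_union_add_card_inter]
  refine Nat.add_le_add (card_le_card ?_) (card_le_card ?_)
  · rw [← inter_union_distrib_left]
    exact inter_subset_inter_left (union_subset (sym2_mono subset_union_left)
      (sym2_mono subset_union_right))
  · intro e
    simp only [mem_inter, mem_sym2_iff]
    tauto

lemma IsSparse.isTight_union_inter (hH : IsSparse m H) (hX : IsTight m H X) (hY : IsTight m H Y)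
    (hXY : (X ∩ Y).Nonempty) : IsTight m H (X ∪ Y) ∧ IsTight m H (X ∩ Y) := by
  have h1 := hH _ (hX.1.mono (subset_union_left (s₂ := Y)))
  have h2 := hH _ hXY
  have h3 := card_inter_sym2_add_le H X Y
  have h4 : m * #(X ∪ Y) + m * #(X ∩ Y) = m * #X + m * #Y := by
    rw [← mul_add, ← mul_add, card_union_add_card_inter]
  have h5 := hX.2
  have h6 := hY.2
  exact ⟨⟨hX.1.mono subset_union_left, by omega⟩, ⟨hXY, by omega⟩⟩

/-- Two edge sets of the same size that agree outside `Y` span equally many edges in `Y`. -/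
lemma card_inter_sym2_eq (hcard : #H = #K) (h : H \ Y.sym2 = K \ Y.sym2) :
    #(H ∩ Y.sym2) = #(K ∩ Y.sym2) := by
  have h1 := card_sdiff_add_card_inter H Y.sym2
  have h2 := card_sdiff_add_card_inter K Y.sym2
  rw [h] at h1
  omega

lemma IsTight.congr (hcard : #H = #K) (h : H \ Y.sym2 = K \ Y.sym2) (hY : IsTight m H Y) :
    IsTight m K Y :=
  ⟨hY.1, card_inter_sym2_eq hcard h ▸ hY.2⟩

/-- Replacing the part of a sparse set inside a tight set by a part of another sparse set of the
same size preserves sparsity. -/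
lemma IsSparse.replace (hH : IsSparse m H) (hK : IsSparse m K) (hp : IsTight m H p) :
    IsSparse m ((H \ p.sym2) ∪ (K ∩ p.sym2)) := by
  intro X hX
  by_cases hXp : (X ∩ p).Nonempty
  · have h1 := hK _ hXp
    have h2 := hH _ (hX.mono (subset_union_left (s₂ := p)))
    have h3 := hp.2
    have h4 : m * #(X ∪ p) + m * #(X ∩ p) = m * #X + m * #p := by
      rw [← mul_add, ← mul_add, card_union_add_card_inter]
    have h5 : #(((H \ p.sym2) ∪ (K ∩ p.sym2)) ∩ X.sym2) ≤
        #((H ∩ X.sym2) \ p.sym2) + #(K ∩ (X ∩ p).sym2) := by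
      refine (card_le_card ?_).trans (card_union_le _ _)
      intro e
      simp only [mem_inter, mem_union, mem_sdiff, mem_sym2_iff]
      tauto
    have h6 : #((H ∩ X.sym2) \ p.sym2) + #(H ∩ p.sym2) ≤ #(H ∩ (X ∪ p).sym2) := by
      rw [← card_union_of_disjoint]
      · refine card_le_card ?_
        intro e
        simp only [mem_inter, mem_union, mem_sdiff, mem_sym2_iff]
        tauto
      · rw [disjoint_left]
        intro e
        simp only [mem_inter, mem_sdiff]
        tauto
    omega
  · have h1 : ((H \ p.sym2) ∪ (K ∩ p.sym2)) ∩ X.sym2 ⊆ H ∩ X.sym2 := by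
      intro e he
      simp only [mem_inter, mem_union, mem_sdiff] at he ⊢
      refine ⟨?_, he.2⟩
      rcases he.1 with h | h
      · exact h.1
      · exfalso
        induction e with | _ a b =>
        exact hXp ⟨a, mem_inter.2 ⟨(mk_mem_sym2_iff.1 he.2).1, (mk_mem_sym2_iff.1 h.2).1⟩⟩
    exact (Nat.add_le_add_right (card_le_card h1) m).trans (hH X hX)

/-- Exchange property: an edge `e` may replace an edge `g` lying in every tight set that
spans `e`. -/
lemma IsSparse.exchange (hH : IsSparse m H) {e g : Sym2 V} (hg : g ∈ H)
    (h : ∀ X, IsTight m H X → e ∈ X.sym2 → g ∈ X.sym2) : IsSparse m (insert e (H.erase g)) := by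
  intro X hX
  have h0 := hH X hX
  by_cases he : e ∈ X.sym2
  · rw [insert_inter_of_mem he]
    have h1 := card_insert_le e (H.erase g ∩ X.sym2)
    by_cases ht : IsTight m H X
    · have h2 : #(H.erase g ∩ X.sym2) < #(H ∩ X.sym2) := by
        refine card_lt_card ⟨inter_subset_inter_right (erase_subset _ _), fun hs => ?_⟩
        have := hs (mem_inter.2 ⟨hg, h X ht he⟩)
        simp at this
      omega
    · have h2 : #(H.erase g ∩ X.sym2) ≤ #(H ∩ X.sym2) :=
        card_le_card (inter_subset_inter_right (erase_subset _ _))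
      have h3 : #(H ∩ X.sym2) + m ≠ m * #X := fun h => ht ⟨hX, h⟩
      omega
  · rw [insert_inter_of_notMem he]
    exact (Nat.add_le_add_right (card_le_card
      (inter_subset_inter_right (erase_subset _ _))) m).trans h0

lemma IsSparse.exists_tight_of_not_insert (hH : IsSparse m H) {e : Sym2 V}
    (h : ¬ IsSparse m (insert e H)) : ∃ X, IsTight m H X ∧ e ∈ X.sym2 := by
  by_contra! hcon
  refine h fun X hX => ?_
  have h0 := hH X hX
  by_cases he : e ∈ X.sym2
  · have h3 : #(H ∩ X.sym2) + m ≠ m * #X := fun h => hcon X ⟨hX, h⟩ he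
    rw [insert_inter_of_mem he]
    have h1 := card_insert_le e (H ∩ X.sym2)
    omega
  · rwa [insert_inter_of_notMem he]

/-- In a tight set with at least two vertices, every vertex is incident with a spanned edge. -/
lemma IsSparse.exists_edge_of_tight (hH : IsSparse m H) (hm : 0 < m) (hX : IsTight m H X) {v w : V}
    (hv : v ∈ X) (hw : w ∈ X) (hvw : w ≠ v) : ∃ g ∈ H, g ∈ X.sym2 ∧ v ∈ g := by
  by_contra! hcon
  have h1 := hH (X.erase v) ⟨w, mem_erase.2 ⟨hvw, hw⟩⟩
  have h2 : H ∩ X.sym2 ⊆ H ∩ (X.erase v).sym2 := by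
    intro e he
    rw [mem_inter] at he ⊢
    refine ⟨he.1, mem_sym2_iff.2 fun a ha => mem_erase.2 ⟨?_, mem_sym2_iff.1 he.2 a ha⟩⟩
    rintro rfl
    exact hcon e he.1 he.2 ha
  have h3 := card_le_card h2
  have h4 := hX.2
  have h5 := card_erase_add_one hv
  rw [← h5, mul_add, mul_one] at h4
  omega

variable [Fintype V]

/-- If `V` is tight, then any two vertices lie in a smallest tight set. -/
lemma IsSparse.exists_least_tight (hH : IsSparse m H) (huniv : IsTight m H univ) (x y : V) :
    ∃ X, IsTight m H X ∧ x ∈ X ∧ y ∈ X ∧ ∀ Y, IsTight m H Y → x ∈ Y → y ∈ Y → X ⊆ Y := by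
  obtain ⟨X, hX, hmin⟩ := exists_min_image
    (univ.filter fun X : Finset V => IsTight m H X ∧ x ∈ X ∧ y ∈ X) card
    ⟨univ, by simpa using huniv⟩
  simp only [mem_filter, mem_univ, true_and] at hX hmin
  refine ⟨X, hX.1, hX.2.1, hX.2.2, fun Y hY hxY hyY => ?_⟩
  have hx : x ∈ X ∩ Y := mem_inter.2 ⟨hX.2.1, hxY⟩
  have h1 := hmin (X ∩ Y) ⟨(hH.isTight_union_inter hX.1 hY ⟨x, hx⟩).2, hx,
    mem_inter.2 ⟨hX.2.2, hyY⟩⟩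
  rw [← eq_of_subset_of_card_le inter_subset_left h1]
  exact inter_subset_right

/-- The union of all tight sets that contain `v` and avoid `S`. -/
noncomputable def tightBlock (m : ℕ) (H : Finset (Sym2 V)) (S : Finset V) (v : V) : Finset V :=
  univ.filter fun w => ∃ p, IsTight m H p ∧ Disjoint p S ∧ v ∈ p ∧ w ∈ p

variable {S : Finset V}

lemma IsSparse.tightBlock_spec (hH : IsSparse m H) {v : V} (hv : v ∉ S) :
    IsTight m H (tightBlock m H S v) ∧ Disjoint (tightBlock m H S v) S ∧
      v ∈ tightBlock m H S v := by
  obtain ⟨p, hp, hmax⟩ := exists_max_image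
    (univ.filter fun p : Finset V => IsTight m H p ∧ Disjoint p S ∧ v ∈ p) card
    ⟨{v}, by simpa [hH.isTight_singleton] using hv⟩
  simp only [mem_filter, mem_univ, true_and] at hp hmax
  have : tightBlock m H S v = p := by
    ext w
    simp only [tightBlock, mem_filter, mem_univ, true_and]
    refine ⟨?_, fun hw => ⟨p, hp.1, hp.2.1, hp.2.2, hw⟩⟩
    rintro ⟨q, hq, hqS, hvq, hwq⟩
    have hu := (hH.isTight_union_inter hp.1 hq ⟨v, mem_inter.2 ⟨hp.2.2, hvq⟩⟩).1
    have h1 := hmax (p ∪ q) ⟨hu, disjoint_union_left.2 ⟨hp.2.1, hqS⟩, mem_union_left _ hp.2.2⟩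
    rw [eq_of_subset_of_card_le subset_union_left h1]
    exact mem_union_right _ hwq
  rw [this]
  exact hp

lemma IsSparse.tightBlock_eq_iff (hH : IsSparse m H) {v w : V} (hw : w ∉ S) :
    tightBlock m H S v = tightBlock m H S w ↔
      ∃ p, IsTight m H p ∧ Disjoint p S ∧ v ∈ p ∧ w ∈ p := by
  constructor
  · intro h
    have := (hH.tightBlock_spec hw).2.2
    rw [← h] at this
    simpa [tightBlock] using this
  · rintro ⟨p, hp, hpS, hv, hw⟩
    have key : ∀ a ∈ p, ∀ b ∈ p, tightBlock m H S a ⊆ tightBlock m H S b := by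
      intro a ha b hb c hc
      simp only [tightBlock, mem_filter, mem_univ, true_and] at hc ⊢
      obtain ⟨q, hq, hqS, haq, hcq⟩ := hc
      exact ⟨p ∪ q, (hH.isTight_union_inter hp hq ⟨a, mem_inter.2 ⟨ha, haq⟩⟩).1,
        disjoint_union_left.2 ⟨hpS, hqS⟩, mem_union_left _ hb, mem_union_right _ hcq⟩
    exact (key v hv w hw).antisymm (key w hw v hv)

/-- Counting the edges that avoid `S` by means of the partition of `V ∖ S` into tight blocks. -/
lemma IsSparse.card_inter_compl_sym2 (hH : IsSparse m H) (S : Finset V) :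
    #(H ∩ (Sᶜ).sym2) + m * #((Sᶜ).image (tightBlock m H S)) =
      m * #(Sᶜ) + #((H ∩ (Sᶜ).sym2).filter fun e => ¬ (e.map (tightBlock m H S)).IsDiag) := by
  have hP : ∀ p ∈ (Sᶜ).image (tightBlock m H S),
      IsTight m H p ∧ p ⊆ Sᶜ ∧ ∀ v ∈ p, tightBlock m H S v = p := by
    intro p hp
    obtain ⟨v, hv, rfl⟩ := mem_image.1 hp
    rw [mem_compl] at hv
    obtain ⟨h1, h2, h3⟩ := hH.tightBlock_spec hv
    exact ⟨h1, subset_compl_iff_disjoint_right.2 h2, fun w hw =>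
      (hH.tightBlock_eq_iff hv).2 ⟨_, h1, h2, hw, h3⟩⟩
  have hdisj : ∀ p ∈ (Sᶜ).image (tightBlock m H S), ∀ q ∈ (Sᶜ).image (tightBlock m H S),
      ∀ v, v ∈ p → v ∈ q → p = q := fun p hp q hq v hvp hvq =>
    ((hP p hp).2.2 v hvp).symm.trans ((hP q hq).2.2 v hvq)
  have h1 : #(Sᶜ) = ∑ p ∈ (Sᶜ).image (tightBlock m H S), #p := by
    rw [← card_biUnion]
    · congr 1
      ext v
      rw [mem_biUnion]
      refine ⟨fun hv => ⟨_, mem_image_of_mem _ hv, (hH.tightBlock_spec (mem_compl.1 hv)).2.2⟩, ?_⟩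
      rintro ⟨p, hp, hv⟩
      exact (hP p hp).2.1 hv
    · intro p hp q hq hpq
      exact disjoint_left.2 fun v hv hv' => hpq (hdisj p hp q hq v hv hv')
  have h2 : #((H ∩ (Sᶜ).sym2).filter fun e => (e.map (tightBlock m H S)).IsDiag) =
      ∑ p ∈ (Sᶜ).image (tightBlock m H S), #(H ∩ p.sym2) := by
    rw [← card_biUnion]
    · congr 1
      ext e
      induction e with | _ a b =>
      simp only [mem_filter, mem_inter, mk_mem_sym2_iff, Sym2.map_mk, Sym2.mk_isDiag_iff,
        mem_biUnion]
      constructor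
      · rintro ⟨⟨he, ha, hb⟩, hab⟩
        refine ⟨_, mem_image_of_mem _ ha, he, (hH.tightBlock_spec (mem_compl.1 ha)).2.2, ?_⟩
        rw [hab]
        exact (hH.tightBlock_spec (mem_compl.1 hb)).2.2
      · rintro ⟨p, hp, he, ha, hb⟩
        obtain ⟨-, h2, h3⟩ := hP p hp
        exact ⟨⟨he, h2 ha, h2 hb⟩, (h3 a ha).trans (h3 b hb).symm⟩
    · intro p hp q hq hpq
      refine disjoint_left.2 fun e he he' => ?_
      induction e with | _ a b =>
      simp only [mem_inter, mk_mem_sym2_iff] at he he'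
      exact hpq (hdisj p hp q hq a he.2.1 he'.2.1)
  have h3 : ∑ p ∈ (Sᶜ).image (tightBlock m H S), #(H ∩ p.sym2) +
      m * #((Sᶜ).image (tightBlock m H S)) = m * #(Sᶜ) := by
    rw [h1, mul_sum, mul_comm m, ← smul_eq_mul (b := m), ← sum_const, ← sum_add_distrib]
    exact sum_congr rfl fun p hp => (hP p hp).1.2
  have h4 := card_filter_add_card_filter_not (s := H ∩ (Sᶜ).sym2)
    (fun e => (e.map (tightBlock m H S)).IsDiag)
  omega

end SparseEdgeSets

section DegreeBoundedBases

variable {V : Type*} {m : ℕ} {H K : Finset (Sym2 V)} {p q : Finset V}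

/-- The number of edges of `H` incident with `v`. -/
noncomputable def edgeDegree (H : Finset (Sym2 V)) (v : V) : ℕ := #(H.filter fun e => v ∈ e)

lemma edgeDegree_congr {v : V} (h : ∀ e, v ∈ e → (e ∈ H ↔ e ∈ K)) :
    edgeDegree H v = edgeDegree K v := by
  unfold edgeDegree
  congr 1
  ext e
  simp only [mem_filter]
  exact and_congr_left (h e)

lemma edgeDegree_congr_of_notMem {v : V} (h : ∀ e, e ∉ p.sym2 → (e ∈ H ↔ e ∈ K)) (hv : v ∉ p) :
    edgeDegree H v = edgeDegree K v :=
  edgeDegree_congr fun e he => h e fun h => hv (mem_sym2_iff.1 h v he)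

lemma edgeDegree_insert_erase_le (e g : Sym2 V) (v : V) :
    edgeDegree (insert e (H.erase g)) v ≤ edgeDegree H v + 1 := by
  refine (card_le_card (t := insert e (H.filter fun e => v ∈ e)) ?_).trans (card_insert_le _ _)
  intro f
  simp only [mem_filter, mem_insert, mem_erase]
  tauto

lemma edgeDegree_insert_erase_le_of_notMem {e : Sym2 V} (g : Sym2 V) {v : V} (hv : v ∉ e) :
    edgeDegree (insert e (H.erase g)) v ≤ edgeDegree H v := by
  refine card_le_card fun f => ?_
  simp only [mem_filter, mem_insert, mem_erase]
  rintro ⟨rfl | hf, hvf⟩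
  · exact absurd hvf hv
  · exact ⟨hf.2, hvf⟩

lemma edgeDegree_insert_erase_lt {e g : Sym2 V} {v : V} (hv : v ∉ e) (hg : g ∈ H) (hvg : v ∈ g) :
    edgeDegree (insert e (H.erase g)) v < edgeDegree H v := by
  refine card_lt_card ⟨fun f => ?_, fun hs => ?_⟩
  · simp only [mem_filter, mem_insert, mem_erase]
    rintro ⟨rfl | hf, hvf⟩
    · exact absurd hvf hv
    · exact ⟨hf.2, hvf⟩
  · have := hs (mem_filter.2 ⟨hg, hvg⟩)
    simp only [mem_filter, mem_insert, mem_erase, ne_eq, not_true, false_and, or_false] at this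
    exact hv (this.1 ▸ hvg)

lemma sdiff_eq_sdiff_of_forall {A : Finset (Sym2 V)} (h : ∀ e, e ∉ A → (e ∈ K ↔ e ∈ H)) :
    K \ A = H \ A := by
  ext e
  simp only [mem_sdiff]
  exact and_congr_left (h e)

variable [Fintype V]

lemma sum_edgeDegree_le (H : Finset (Sym2 V)) (S : Finset V) :
    ∑ v ∈ S, edgeDegree H v ≤ #(H \ (Sᶜ).sym2) + #(H ∩ S.sym2) := by
  have h1 : ∑ v ∈ S, edgeDegree H v = ∑ e ∈ H, #(S.filter fun v => v ∈ e) := by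
    simp only [edgeDegree, card_filter]
    exact sum_comm
  have h2 : H \ (Sᶜ).sym2 = H.filter fun e => e ∉ (Sᶜ).sym2 := by
    ext
    simp
  rw [h1, h2, ← filter_mem_eq_inter, card_filter, card_filter, ← sum_add_distrib]
  refine sum_le_sum fun e _ => ?_
  induction e with | _ a b =>
  simp only [mk_mem_sym2_iff, mem_compl]
  have hsub : (S.filter fun v => v ∈ s(a, b)) ⊆ {a, b} := by
    intro v hv
    simpa using (mem_filter.1 hv).2
  by_cases ha : a ∈ S <;> by_cases hb : b ∈ S
  · simpa [ha, hb] using (card_le_card hsub).trans card_le_two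
  · have : (S.filter fun v => v ∈ s(a, b)) ⊆ {a} := by
      intro v hv
      have := hsub hv
      simp only [mem_insert, mem_singleton, mem_filter] at this hv ⊢
      rcases this with h | rfl
      · exact h
      · exact absurd hv.1 hb
    simpa [ha, hb] using card_le_card this
  · have : (S.filter fun v => v ∈ s(a, b)) ⊆ {b} := by
      intro v hv
      have := hsub hv
      simp only [mem_insert, mem_singleton, mem_filter] at this hv ⊢
      rcases this with rfl | h
      · exact absurd hv.1 ha
      · exact h
    simpa [ha, hb] using card_le_card this
  · have : (S.filter fun v => v ∈ s(a, b)) = ∅ := by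
      rw [filter_eq_empty_iff]
      intro v hv hv'
      rcases Sym2.mem_iff.1 hv' with rfl | rfl
      · exact ha hv
      · exact hb hv
    rw [this, card_empty]
    exact Nat.zero_le _

/-- `H` is an `m`-sparse set of edges of `G` of the maximum conceivable size `m (|V| - 1)`. -/
structure IsSparseBase (G : SimpleGraph V) (m : ℕ) (H : Finset (Sym2 V)) : Prop where
  isSparse : IsSparse m H
  subset : H ⊆ G.edgeFinset
  card_add : #H + m = m * Fintype.card V

variable {G : SimpleGraph V}

lemma IsSparseBase.isTight_univ [Nonempty V] (hH : IsSparseBase G m H) : IsTight m H univ :=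
  ⟨univ_nonempty, by simpa using hH.card_add⟩

/-- The partition bound for `G`, rephrased for a sparse set `H` such that every edge of `G − S`
outside `H` is spanned by a tight set avoiding `S`. -/
lemma IsSparse.mul_card_compl_le (hH : IsSparse m H)
    (hpart : ∀ (c : V → Finset V) (S : Finset V), m * #((Sᶜ).image c) ≤
      #((G.edgeFinset ∩ (Sᶜ).sym2).filter fun e => ¬ (e.map c).IsDiag) + #S + m) {S : Finset V}
    (hS : ∀ x ∉ S, ∀ y ∉ S, G.Adj x y → s(x, y) ∉ H →
      ∃ p, IsTight m H p ∧ Disjoint p S ∧ x ∈ p ∧ y ∈ p) :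
    m * #(Sᶜ) ≤ #(H ∩ (Sᶜ).sym2) + #S + m := by
  have h1 := hH.card_inter_compl_sym2 S
  have h2 := hpart (tightBlock m H S) S
  have h3 : ((G.edgeFinset ∩ (Sᶜ).sym2).filter fun e => ¬ (e.map (tightBlock m H S)).IsDiag) ⊆
      (H ∩ (Sᶜ).sym2).filter fun e => ¬ (e.map (tightBlock m H S)).IsDiag := by
    intro e he
    induction e with | _ x y =>
    simp only [mem_filter, mem_inter, SimpleGraph.mem_edgeFinset, SimpleGraph.mem_edgeSet,
      mk_mem_sym2_iff, mem_compl, Sym2.map_mk, Sym2.mk_isDiag_iff] at he ⊢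
    refine ⟨⟨?_, he.1.2⟩, he.2⟩
    by_contra hxy
    exact he.2 ((hH.tightBlock_eq_iff he.1.2.2).2
      (hS x he.1.2.1 y he.1.2.2 he.1.1 hxy))
  have h4 := card_le_card h3
  omega

lemma exists_isSparseBase [Nonempty V]
    (hpart : ∀ (c : V → Finset V) (S : Finset V), m * #((Sᶜ).image c) ≤
      #((G.edgeFinset ∩ (Sᶜ).sym2).filter fun e => ¬ (e.map c).IsDiag) + #S + m) :
    ∃ H, IsSparseBase G m H := by
  obtain ⟨H, hH, hmax⟩ := exists_max_image
    (univ.filter fun H : Finset (Sym2 V) => IsSparse m H ∧ H ⊆ G.edgeFinset) card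
    ⟨∅, by
      simp only [mem_filter, mem_univ, true_and, empty_subset, and_true]
      intro X hX
      simpa using Nat.le_mul_of_pos_right m hX.card_pos⟩
  simp only [mem_filter, mem_univ, true_and] at hH hmax
  refine ⟨H, hH.1, hH.2, ?_⟩
  have h1 := hH.1.mul_card_compl_le hpart (S := ∅) fun x _ y _ hxy hxyH => by
    have : ¬ IsSparse m (insert s(x, y) H) := fun hs => by
      have := hmax _ ⟨hs, insert_subset (by simpa using hxy) hH.2⟩
      rw [card_insert_of_notMem hxyH] at this
      omega
    obtain ⟨p, hp, hxyp⟩ := hH.1.exists_tight_of_not_insert this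
    rw [mk_mem_sym2_iff] at hxyp
    exact ⟨p, hp, disjoint_empty_right p, hxyp⟩
  have h2 := hH.1 univ univ_nonempty
  simp only [compl_empty, sym2_univ, inter_univ, card_univ, card_empty] at h1 h2
  omega

/-- Inside the tight set `p`, the base `H` can be modified so that the degree of `v` drops below
`h v` while no degree exceeds the larger of its bound and its old value. -/
def IsReducible (G : SimpleGraph V) (m : ℕ) (h : V → ℕ) (H : Finset (Sym2 V)) (p : Finset V)
    (v : V) : Prop :=
  IsTight m H p ∧ v ∈ p ∧ ∃ K, IsSparseBase G m K ∧ (∀ e, e ∉ p.sym2 → (e ∈ K ↔ e ∈ H)) ∧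
    (∀ w, edgeDegree K w ≤ max (h w) (edgeDegree H w)) ∧ edgeDegree K v < h v

/-- If the ends of a missing edge are reducible inside disjoint tight sets, then inserting that
edge allows one to lower the degree of any vertex in the resulting tight set. -/
lemma IsSparseBase.exists_reroute [Nonempty V] (hm : 0 < m) (hH : IsSparseBase G m H) {h : V → ℕ}
    {x y : V} (hx : IsReducible G m h H p x) (hy : IsReducible G m h H q y) (hpq : Disjoint p q)
    (hxy : G.Adj x y) (hxyH : s(x, y) ∉ H) :
    ∃ r, IsTight m H r ∧ x ∈ r ∧ y ∈ r ∧ ∀ v ∈ r, v ∉ p → v ∉ q →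
      ∃ K, IsSparseBase G m K ∧ (∀ e, e ∉ r.sym2 → (e ∈ K ↔ e ∈ H)) ∧
        (∀ w, edgeDegree K w ≤ max (h w) (edgeDegree H w)) ∧ edgeDegree K v < edgeDegree H v := by
  obtain ⟨hp, hxp, K₁, hK₁, hout₁, hdeg₁, hlt₁⟩ := hx
  obtain ⟨hq, hyq, K₂, hK₂, hout₂, hdeg₂, hlt₂⟩ := hy
  have hyp : y ∉ p := disjoint_right.1 hpq hyq
  have hxq : x ∉ q := disjoint_left.1 hpq hxp
  have hsym : ∀ e, e ∈ p.sym2 → e ∉ q.sym2 := by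
    intro e hep heq
    induction e with | _ a b =>
    exact disjoint_left.1 hpq (mk_mem_sym2_iff.1 hep).1 (mk_mem_sym2_iff.1 heq).1
  have hcard : ∀ {A B : Finset (Sym2 V)}, IsSparseBase G m A → IsSparseBase G m B → #A = #B :=
    fun hA hB => by have := hA.card_add; have := hB.card_add; omega
  have hK₁q : K₁ ∩ q.sym2 = H ∩ q.sym2 := by
    ext e
    simp only [mem_inter]
    exact and_congr_left fun he => hout₁ e fun h => hsym e h he
  set L := (K₁ \ q.sym2) ∪ (K₂ ∩ q.sym2) with hL
  have hLK₁ : ∀ e, e ∉ q.sym2 → (e ∈ L ↔ e ∈ K₁) := by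
    intro e he
    simp [hL, he]
  have hLK₂ : ∀ e, e ∉ p.sym2 → (e ∈ L ↔ e ∈ K₂) := by
    intro e he
    by_cases heq : e ∈ q.sym2
    · simp [hL, heq]
    · rw [hLK₁ e heq, hout₁ e he, hout₂ e heq]
  have hLH : ∀ e, e ∉ p.sym2 → e ∉ q.sym2 → (e ∈ L ↔ e ∈ H) := fun e hep heq =>
    (hLK₁ e heq).trans (hout₁ e hep)
  have hqcard := card_inter_sym2_eq (hcard hK₂ hH) (sdiff_eq_sdiff_of_forall hout₂)
  have hpcard := card_inter_sym2_eq (hcard hK₁ hH) (sdiff_eq_sdiff_of_forall hout₁)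
  have hLbase : IsSparseBase G m L := by
    refine ⟨hK₁.isSparse.replace hK₂.isSparse ⟨hq.1, by rw [hK₁q]; exact hq.2⟩,
      union_subset (sdiff_subset.trans hK₁.subset) (inter_subset_left.trans hK₂.subset), ?_⟩
    rw [← hK₁.card_add, hL, card_union_of_disjoint, hqcard, ← hK₁q, card_sdiff_add_card_inter]
    exact disjoint_sdiff.symm.mono_right inter_subset_right
  have hLp : IsTight m L p := by
    refine ⟨hp.1, ?_⟩
    have : L ∩ p.sym2 = K₁ ∩ p.sym2 := by
      ext e
      simp only [mem_inter]
      exact and_congr_left fun he => hLK₁ e (hsym e he)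
    rw [this, hpcard]
    exact hp.2
  have hLq : IsTight m L q := by
    refine ⟨hq.1, ?_⟩
    have : L ∩ q.sym2 = K₂ ∩ q.sym2 := by
      ext e
      simp only [mem_inter]
      exact and_congr_left fun he => hLK₂ e fun h => hsym e h he
    rw [this, hqcard]
    exact hq.2
  have hsdiff : ∀ Y : Finset V, p ⊆ Y → q ⊆ Y → L \ Y.sym2 = H \ Y.sym2 := fun Y hpY hqY =>
    sdiff_eq_sdiff_of_forall fun e he =>
      hLH e (fun h => he (sym2_mono hpY h)) (fun h => he (sym2_mono hqY h))
  obtain ⟨X, hX, hxX, hyX, hXmin⟩ := hH.isSparse.exists_least_tight hH.isTight_univ x y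
  obtain ⟨Y, hY, hxY, hyY, hYmin⟩ := hLbase.isSparse.exists_least_tight hLbase.isTight_univ x y
  have hXr : IsTight m H (X ∪ p ∪ q) :=
    (hH.isSparse.isTight_union_inter (hH.isSparse.isTight_union_inter hX hp
      ⟨x, mem_inter.2 ⟨hxX, hxp⟩⟩).1 hq ⟨y, mem_inter.2 ⟨mem_union_left _ hyX, hyq⟩⟩).1
  have hYr : IsTight m L (Y ∪ p ∪ q) :=
    (hLbase.isSparse.isTight_union_inter (hLbase.isSparse.isTight_union_inter hY hLp
      ⟨x, mem_inter.2 ⟨hxY, hxp⟩⟩).1 hLq ⟨y, mem_inter.2 ⟨mem_union_left _ hyY, hyq⟩⟩).1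
  have hps : ∀ Z : Finset V, p ⊆ Z ∪ p ∪ q := fun Z =>
    subset_union_right.trans subset_union_left
  have hXY : X ⊆ Y ∪ p ∪ q := hXmin _
    (hYr.congr (hcard hLbase hH) (hsdiff _ (hps Y) subset_union_right))
    (hps Y hxp) (subset_union_right hyq)
  have hYX : Y ⊆ X ∪ p ∪ q := hYmin _
    (hXr.congr (hcard hH hLbase) (hsdiff _ (hps X) subset_union_right).symm)
    (hps X hxp) (subset_union_right hyq)
  refine ⟨X ∪ p ∪ q, hXr, hps X hxp, subset_union_right hyq, fun v hv hvp hvq => ?_⟩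
  have hvY : v ∈ Y := by
    have : v ∈ X := by simpa [hvp, hvq] using hv
    simpa [hvp, hvq] using hXY this
  have hvx : v ≠ x := fun h => hvp (h ▸ hxp)
  have hvy : v ≠ y := fun h => hvq (h ▸ hyq)
  have hvxy : v ∉ s(x, y) := by simp [hvx, hvy]
  obtain ⟨g, hgL, hgY, hvg⟩ := hLbase.isSparse.exists_edge_of_tight hm hY hvY hxY hvx.symm
  have hxyL : s(x, y) ∉ L := by
    rw [hLH]
    · exact hxyH
    · simp [hyp]
    · simp [hxq]
  refine ⟨insert s(x, y) (L.erase g), ⟨?_, ?_, ?_⟩, ?_, ?_, ?_⟩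
  · refine hLbase.isSparse.exchange hgL fun Z hZ hxyZ => ?_
    rw [mk_mem_sym2_iff] at hxyZ
    exact sym2_mono (hYmin Z hZ hxyZ.1 hxyZ.2) hgY
  · exact insert_subset (by simpa using hxy) ((erase_subset _ _).trans hLbase.subset)
  · rw [card_insert_of_notMem fun h => hxyL (mem_of_mem_erase h), card_erase_add_one hgL]
    exact hLbase.card_add
  · intro e he
    have h1 : e ≠ s(x, y) := by
      rintro rfl
      exact he (mk_mem_sym2_iff.2 ⟨hps X hxp, subset_union_right hyq⟩)
    have h2 : e ≠ g := by
      rintro rfl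
      exact he (sym2_mono hYX hgY)
    rw [mem_insert, mem_erase, ← hLH e (fun h => he (sym2_mono (hps X) h))
      (fun h => he (sym2_mono subset_union_right h))]
    simp [h1, h2]
  · intro w
    by_cases hwx : w = x
    · subst hwx
      have h1 := edgeDegree_insert_erase_le (H := L) s(w, y) g w
      rw [edgeDegree_congr_of_notMem hLK₁ hxq] at h1
      exact le_max_of_le_left (by omega)
    by_cases hwy : w = y
    · subst hwy
      have h1 := edgeDegree_insert_erase_le (H := L) s(x, w) g w
      rw [edgeDegree_congr_of_notMem hLK₂ hyp] at h1
      exact le_max_of_le_left (by omega)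
    refine (edgeDegree_insert_erase_le_of_notMem g (by simp [hwx, hwy])).trans ?_
    by_cases hwp : w ∈ p
    · rw [edgeDegree_congr_of_notMem hLK₁ (disjoint_left.1 hpq hwp)]
      exact hdeg₁ w
    · rw [edgeDegree_congr_of_notMem hLK₂ hwp]
      exact hdeg₂ w
  · refine (edgeDegree_insert_erase_lt hvxy hgL hvg).trans_eq ?_
    rw [edgeDegree_congr_of_notMem hLK₁ hvq, edgeDegree_congr_of_notMem hout₁ hvp]

/-- A Win-type theorem: under the partition bound, some base obeys the degree bounds `h`. -/
theorem exists_isSparseBase_edgeDegree_le [Nonempty V] (hm : 0 < m)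
    (hpart : ∀ (c : V → Finset V) (S : Finset V), m * #((Sᶜ).image c) ≤
      #((G.edgeFinset ∩ (Sᶜ).sym2).filter fun e => ¬ (e.map c).IsDiag) + #S + m)
    (h : V → ℕ) (hh : ∀ S : Finset V, (2 * m + 1) * #S ≤ ∑ v ∈ S, h v + m) :
    ∃ H, IsSparseBase G m H ∧ ∀ v, edgeDegree H v ≤ h v := by
  obtain ⟨H₀, hH₀⟩ := exists_isSparseBase hpart
  obtain ⟨H, hH, hmin⟩ := exists_min_image (univ.filter (IsSparseBase G m))
    (fun H => ∑ v, (edgeDegree H v - h v)) ⟨H₀, by simpa using hH₀⟩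
  simp only [mem_filter, mem_univ, true_and] at hH hmin
  refine ⟨H, hH, ?_⟩
  by_contra! hbad
  obtain ⟨z, hz⟩ := hbad
  have hnoimp : ∀ K, IsSparseBase G m K → (∀ w, edgeDegree K w ≤ max (h w) (edgeDegree H w)) →
      ∀ v, edgeDegree K v < edgeDegree H v → edgeDegree H v ≤ h v := by
    intro K hK hdeg v hv
    by_contra! hcon
    refine (hmin K hK).not_gt (sum_lt_sum (fun w _ => ?_) ⟨v, mem_univ v, by omega⟩)
    have := hdeg w
    omega
  let Inv : Finset V → Prop := fun S => (∀ v ∈ S, h v ≤ edgeDegree H v) ∧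
    (∀ v, h v < edgeDegree H v → v ∈ S) ∧ ∀ v ∉ S, ∃ p, Disjoint p S ∧ IsReducible G m h H p v
  have hinit : Inv (univ.filter fun v => h v ≤ edgeDegree H v) := by
    refine ⟨fun v hv => by simpa using hv, fun v hv => by simpa using hv.le, fun v hv => ?_⟩
    exact ⟨{v}, disjoint_singleton_left.2 hv, hH.isSparse.isTight_singleton v,
      mem_singleton_self v, H, hH, fun _ _ => Iff.rfl, fun _ => le_max_right _ _,
      by simpa using hv⟩
  obtain ⟨S, hS, hSmin⟩ := exists_min_image (univ.filter Inv) card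
    ⟨_, mem_filter.2 ⟨mem_univ _, hinit⟩⟩
  simp only [mem_filter, mem_univ, true_and] at hS hSmin
  obtain ⟨hS₁, hS₂, hS₃⟩ := hS
  have hcover : ∀ x ∉ S, ∀ y ∉ S, G.Adj x y → s(x, y) ∉ H →
      ∃ p, IsTight m H p ∧ Disjoint p S ∧ x ∈ p ∧ y ∈ p := by
    intro x hx y hy hxy hxyH
    by_contra! hcon
    obtain ⟨p, hpS, hp⟩ := hS₃ x hx
    obtain ⟨q, hqS, hq⟩ := hS₃ y hy
    have hpq : Disjoint p q := by
      rw [disjoint_iff_inter_eq_empty, ← not_nonempty_iff_eq_empty]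
      intro hne
      exact hcon _ (hH.isSparse.isTight_union_inter hp.1 hq.1 hne).1
        (disjoint_union_left.2 ⟨hpS, hqS⟩) (mem_union_left _ hp.2.1) (mem_union_right _ hq.2.1)
    obtain ⟨r, hr, hxr, hyr, hred⟩ := hH.exists_reroute hm hp hq hpq hxy hxyH
    have hlt : #(S \ r) < #S := by
      refine card_lt_card ⟨sdiff_subset, fun hs => ?_⟩
      refine hcon r hr (disjoint_right.2 fun v hv => (mem_sdiff.1 (hs hv)).2) hxr hyr
    refine (hSmin (S \ r) ⟨fun v hv => hS₁ v (mem_sdiff.1 hv).1, fun v hv => ?_,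
      fun v hv => ?_⟩).not_gt hlt
    · refine mem_sdiff.2 ⟨hS₂ v hv, fun hvr => ?_⟩
      obtain ⟨K, hK, -, hdeg, hKv⟩ := hred v hvr (disjoint_right.1 hpS (hS₂ v hv))
        (disjoint_right.1 hqS (hS₂ v hv))
      exact (hnoimp K hK hdeg v hKv).not_gt hv
    · by_cases hvS : v ∈ S
      · have hvr : v ∈ r := by simpa [hvS] using hv
        obtain ⟨K, hK, hout, hdeg, hKv⟩ := hred v hvr (disjoint_right.1 hpS hvS)
          (disjoint_right.1 hqS hvS)
        exact ⟨r, disjoint_sdiff, hr, hvr, K, hK, hout, hdeg,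
          hKv.trans_le (hnoimp K hK hdeg v hKv)⟩
      · obtain ⟨p', hp'S, hp'⟩ := hS₃ v hvS
        exact ⟨p', hp'S.mono_right sdiff_subset, hp'⟩
  have hzS := hS₂ z hz
  have h1 := hH.isSparse.mul_card_compl_le hpart hcover
  have h2 := hH.isSparse S ⟨z, hzS⟩
  have h3 := sum_edgeDegree_le H S
  have h4 := card_sdiff_add_card_inter H (Sᶜ).sym2
  have h5 := hH.card_add
  have h6 : ∑ v ∈ S, h v < ∑ v ∈ S, edgeDegree H v := sum_lt_sum hS₁ ⟨z, hzS, hz⟩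
  have h7 := hh S
  rw [← card_add_card_compl S, mul_add] at h5
  nlinarith

end DegreeBoundedBases

section ForestDecomposition

open SimpleGraph

variable {V : Type*} {m : ℕ}

lemma reachable_fromEdgeSet_of_forall {A B : Finset (Sym2 V)}
    (h : ∀ a b, s(a, b) ∈ A → (fromEdgeSet (B : Set (Sym2 V))).Reachable a b) {a b : V}
    (hab : (fromEdgeSet (A : Set (Sym2 V))).Reachable a b) :
    (fromEdgeSet (B : Set (Sym2 V))).Reachable a b := by
  obtain ⟨w⟩ := hab
  induction w with
  | nil => rfl
  | cons hadj _ ih => exact (h _ _ (mem_coe.1 ((fromEdgeSet_adj _).1 hadj).1)).trans ih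

lemma isAcyclic_fromEdgeSet_insert {A : Finset (Sym2 V)} {x y : V}
    (hA : (fromEdgeSet (A : Set (Sym2 V))).IsAcyclic)
    (hxy : ¬ (fromEdgeSet (A : Set (Sym2 V))).Reachable x y) :
    (fromEdgeSet (↑(insert s(x, y) A) : Set (Sym2 V))).IsAcyclic := by
  have : fromEdgeSet (↑(insert s(x, y) A) : Set (Sym2 V)) =
      fromEdgeSet (A : Set (Sym2 V)) ⊔ edge x y := by
    rw [edge, ← fromEdgeSet_union, coe_insert, Set.insert_eq, Set.union_comm]
  rw [this, isAcyclic_add_edge_iff_of_not_reachable x y hxy]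
  exact hA

/-- The colour class `i` of the edges of `L` other than `f`. -/
noncomputable def colorClass (L : Finset (Sym2 V)) (c : Sym2 V → Fin m) (f : Sym2 V) (i : Fin m) :
    Finset (Sym2 V) := (L.erase f).filter fun e => c e = i

/-- Edge colourings of `L` with one uncoloured edge that arise from `(c₀, e₀)` by repeatedly
giving the uncoloured edge some colour and uncolouring an edge of that colour separating its
ends. -/
inductive Recolors (L : Finset (Sym2 V)) (c₀ : Sym2 V → Fin m) (e₀ : Sym2 V) :
    (Sym2 V → Fin m) → Sym2 V → Prop
  | refl : Recolors L c₀ e₀ c₀ e₀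
  | step {c : Sym2 V → Fin m} {x y : V} {g : Sym2 V} {i : Fin m} :
    Recolors L c₀ e₀ c s(x, y) → g ∈ colorClass L c s(x, y) i →
    ¬ (fromEdgeSet (↑((colorClass L c s(x, y) i).erase g) : Set (Sym2 V))).Reachable x y →
    Recolors L c₀ e₀ (Function.update c s(x, y) i) g

variable {L : Finset (Sym2 V)} {c c₀ : Sym2 V → Fin m} {e₀ f g : Sym2 V} {i j : Fin m}

lemma colorClass_update_self (hf : f ∈ L) (hg : g ∈ colorClass L c f i) :
    colorClass L (Function.update c f i) g i = insert f ((colorClass L c f i).erase g) := by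
  ext e
  simp only [colorClass, mem_filter, mem_erase, mem_insert] at hg ⊢
  by_cases he : e = f
  · subst he
    simp [hf, Ne.symm hg.1.1]
  · simp [he]
    tauto

lemma colorClass_update_of_ne (hg : g ∈ colorClass L c f i) (hij : j ≠ i) :
    colorClass L (Function.update c f i) g j = colorClass L c f j := by
  ext e
  simp only [colorClass, mem_filter, mem_erase] at hg ⊢
  by_cases he : e = f
  · subst he
    simp [hij.symm]
  · by_cases heg : e = g
    · subst heg
      simp [he, hg.2, hij.symm]
    · simp [he, heg]

lemma Recolors.mem_and_isAcyclic (h : Recolors L c₀ e₀ c f) (he₀ : e₀ ∈ L)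
    (hc₀ : ∀ i, (fromEdgeSet (colorClass L c₀ e₀ i : Set (Sym2 V))).IsAcyclic) :
    f ∈ L ∧ ∀ i, (fromEdgeSet (colorClass L c f i : Set (Sym2 V))).IsAcyclic := by
  induction h with
  | refl => exact ⟨he₀, hc₀⟩
  | @step c x y g i _ hg hreach ih =>
    refine ⟨mem_of_mem_erase (mem_filter.1 hg).1, fun j => ?_⟩
    by_cases hij : j = i
    · subst hij
      rw [colorClass_update_self ih.1 hg]
      exact isAcyclic_fromEdgeSet_insert
        ((ih.2 j).anti (fromEdgeSet_mono (coe_subset.2 (erase_subset _ _)))) hreach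
    · rw [colorClass_update_of_ne hg hij]
      exact ih.2 j

/-- `A` can be coloured by `m` colours such that every colour class is a forest. -/
def IsForestColorable (m : ℕ) (A : Finset (Sym2 V)) : Prop :=
  ∃ c : Sym2 V → Fin m, ∀ i,
    (fromEdgeSet (↑(A.filter fun e => c e = i) : Set (Sym2 V))).IsAcyclic

lemma reachable_of_not_isForestColorable {x y : V} (hL : ¬ IsForestColorable m L)
    (hf : s(x, y) ∈ L)
    (hc : ∀ i, (fromEdgeSet (colorClass L c s(x, y) i : Set (Sym2 V))).IsAcyclic) (i : Fin m) :
    (fromEdgeSet (colorClass L c s(x, y) i : Set (Sym2 V))).Reachable x y := by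
  by_contra hreach
  refine hL ⟨Function.update c s(x, y) i, fun j => ?_⟩
  by_cases hij : j = i
  · subst hij
    have : (L.filter fun e => Function.update c s(x, y) j e = j) =
        insert s(x, y) (colorClass L c s(x, y) j) := by
      ext e
      by_cases he : e = s(x, y)
      · subst he
        simp [hf]
      · simp [colorClass, he]
    rw [this]
    exact isAcyclic_fromEdgeSet_insert (hc j) hreach
  · have : (L.filter fun e => Function.update c s(x, y) i e = j) = colorClass L c s(x, y) j := by
      ext e
      by_cases he : e = s(x, y)
      · subst he
        simp [colorClass, Ne.symm hij]
      · simp [colorClass, he]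
    rw [this]
    exact hc j

/-- In a forest, the edges separating `x` from `y` already connect `x` to `y`. -/
lemma reachable_of_forall_separating {A R : Finset (Sym2 V)} {x y : V}
    (hA : (fromEdgeSet (A : Set (Sym2 V))).IsAcyclic)
    (hxy : (fromEdgeSet (A : Set (Sym2 V))).Reachable x y)
    (hR : ∀ g ∈ A, ¬ (fromEdgeSet (↑(A.erase g) : Set (Sym2 V))).Reachable x y → g ∈ R) :
    (fromEdgeSet (↑(A ∩ R) : Set (Sym2 V))).Reachable x y := by
  obtain ⟨p, hp⟩ := hxy.exists_isPath
  have hmem : ∀ g ∈ p.edges, g ∈ A := fun g hg => by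
    have := p.edges_subset_edgeSet hg
    rw [edgeSet_fromEdgeSet] at this
    exact this.1
  refine ⟨p.transfer _ fun g hg => ?_⟩
  have hgA := p.edges_subset_edgeSet hg
  rw [edgeSet_fromEdgeSet] at hgA ⊢
  refine ⟨mem_coe.2 (mem_inter.2 ⟨hgA.1, hR g hgA.1 fun hreach => ?_⟩), hgA.2⟩
  obtain ⟨q, hq⟩ := hreach.exists_isPath
  have hle : fromEdgeSet (↑(A.erase g) : Set (Sym2 V)) ≤ fromEdgeSet (A : Set (Sym2 V)) :=
    fromEdgeSet_mono (coe_subset.2 (erase_subset _ _))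
  have heq := (hA.subsingleton_path _ _).elim ⟨p, hp⟩ ⟨q.mapLe hle, hq.mapLe hle⟩
  have hpq : p = q.mapLe hle := congrArg Subtype.val heq
  rw [hpq, Walk.edges_mapLe_eq_edges] at hg
  have := q.edges_subset_edgeSet hg
  rw [edgeSet_fromEdgeSet] at this
  simp at this

variable [Fintype V]

lemma card_reachable_le (A : Finset (Sym2 V)) (x : V) :
    #(univ.filter ((fromEdgeSet (A : Set (Sym2 V))).Reachable x)) ≤
      #(A ∩ (univ.filter ((fromEdgeSet (A : Set (Sym2 V))).Reachable x)).sym2) + 1 := by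
  set G := fromEdgeSet (A : Set (Sym2 V)) with hG
  set U := univ.filter (G.Reachable x) with hU
  set C := G.connectedComponentMk x with hC
  have hsupp : C.supp = ↑U := by
    ext v
    rw [ConnectedComponent.mem_supp_iff, hC, ConnectedComponent.eq, reachable_comm]
    simp [hU]
  have h1 : Nat.card C.supp ≤ Nat.card C.toSimpleGraph.edgeSet + 1 :=
    C.connected_toSimpleGraph.card_vert_le_card_edgeSet_add_one
  have h2 : Nat.card C.supp = #U := by
    rw [hsupp, Nat.card_coe_set_eq, Set.ncard_coe_finset]
  have h3 : Nat.card C.toSimpleGraph.edgeSet ≤ #(A ∩ U.sym2) := by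
    rw [Nat.card_coe_set_eq, ← Set.ncard_coe_finset]
    refine Set.ncard_le_ncard_of_injOn (Sym2.map Subtype.val) (fun e => ?_)
      (Sym2.map.injective Subtype.val_injective).injOn (finite_toSet _)
    induction e with | _ a b =>
    intro hab
    have hadj : G.Adj a b := hab
    have hmem : ∀ v : C.supp, (v : V) ∈ U := fun v => mem_coe.1 (hsupp ▸ v.2)
    exact mem_coe.2 (mem_inter.2 ⟨mem_coe.1 ((fromEdgeSet_adj _).1 hadj).1,
      mk_mem_sym2_iff.2 ⟨hmem a, hmem b⟩⟩)
  omega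

/-- The **Nash-Williams arboricity theorem**: an `m`-sparse edge set decomposes into `m` forests. -/
theorem IsSparse.isForestColorable {H : Finset (Sym2 V)} (hm : 0 < m) (hH : IsSparse m H) :
    IsForestColorable m H := by
  induction H using Finset.induction_on with
  | empty => exact ⟨fun _ => ⟨0, hm⟩, fun i => by simp⟩
  | insert e K heK ih =>
    set L := insert e K with hL
    by_contra hcol
    obtain ⟨c₀, hc₀⟩ := ih (hH.mono (subset_insert _ _))
    have heL : e ∈ L := mem_insert_self _ _
    replace hc₀ : ∀ i, (fromEdgeSet (colorClass L c₀ e i : Set (Sym2 V))).IsAcyclic := by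
      intro i
      rw [colorClass, hL, erase_insert heK]
      exact hc₀ i
    set R := L.filter fun f => ∃ c, Recolors L c₀ e c f with hR
    have hreach : ∀ {c x y}, Recolors L c₀ e c s(x, y) → ∀ i,
        (fromEdgeSet (↑(colorClass L c s(x, y) i ∩ R) : Set (Sym2 V))).Reachable x y := by
      intro c x y hc i
      obtain ⟨hf, hac⟩ := hc.mem_and_isAcyclic heL hc₀
      refine reachable_of_forall_separating (hac i)
        (reachable_of_not_isForestColorable hcol hf hac i) fun g hg hsep => ?_
      exact mem_filter.2 ⟨mem_of_mem_erase (mem_filter.1 hg).1, _, hc.step hg hsep⟩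
    have hinv : ∀ {c f}, Recolors L c₀ e c f → ∀ i a b,
        (fromEdgeSet (↑(colorClass L c f i ∩ R) : Set (Sym2 V))).Reachable a b →
        (fromEdgeSet (↑(colorClass L c₀ e i ∩ R) : Set (Sym2 V))).Reachable a b := by
      intro c f hc
      induction hc with
      | refl => exact fun _ _ _ => id
      | @step c x y g i hc hg hsep ih =>
        intro j a b hab
        refine ih j a b (reachable_fromEdgeSet_of_forall (fun a b hab => ?_) hab)
        have hmem : ∀ {A : Finset (Sym2 V)}, s(a, b) ∈ A →
            (fromEdgeSet (A : Set (Sym2 V))).Reachable a b := by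
          intro A hA
          by_cases h : a = b
          · rw [h]
          · exact ((fromEdgeSet_adj _).2 ⟨mem_coe.2 hA, h⟩).reachable
        by_cases hij : j = i
        · subst hij
          rw [colorClass_update_self (hc.mem_and_isAcyclic heL hc₀).1 hg, mem_inter, mem_insert,
            mem_erase] at hab
          rcases hab.1 with h | h
          · rcases Sym2.eq_iff.1 h with ⟨rfl, rfl⟩ | ⟨rfl, rfl⟩
            · exact hreach hc j
            · exact (hreach hc j).symm
          · exact hmem (mem_inter.2 ⟨h.2, hab.2⟩)
        · rw [colorClass_update_of_ne hg hij] at hab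
          exact hmem hab
    induction e with | _ x y =>
    have hclass : ∀ i a b, (fromEdgeSet (R : Set (Sym2 V))).Reachable a b ↔
        (fromEdgeSet (↑(colorClass L c₀ s(x, y) i ∩ R) : Set (Sym2 V))).Reachable a b := by
      intro i a b
      refine ⟨reachable_fromEdgeSet_of_forall fun a b hab => ?_, fun h =>
        h.mono (fromEdgeSet_mono (coe_subset.2 inter_subset_right))⟩
      obtain ⟨c, hc⟩ := (mem_filter.1 hab).2
      exact hinv hc i a b (hreach hc i)
    set U := univ.filter ((fromEdgeSet (R : Set (Sym2 V))).Reachable x) with hU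
    have hxU : x ∈ U := by simp [hU]
    have hyU : y ∈ U := by
      rw [hU, mem_filter, hclass ⟨0, hm⟩]
      exact ⟨mem_univ _, hreach Recolors.refl _⟩
    have h1 : ∀ i : Fin m, #U ≤ #((L.erase s(x, y) ∩ U.sym2).filter fun f => c₀ f = i) + 1 := by
      intro i
      have h := card_reachable_le (colorClass L c₀ s(x, y) i ∩ R) x
      have hUi : univ.filter ((fromEdgeSet
          (↑(colorClass L c₀ s(x, y) i ∩ R) : Set (Sym2 V))).Reachable x) = U :=
        filter_congr fun v _ => (hclass i x v).symm
      rw [hUi] at h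
      refine h.trans (Nat.add_le_add_right (card_le_card fun f => ?_) 1)
      simp only [colorClass, mem_inter, mem_filter]
      tauto
    have h2 : #(L.erase s(x, y) ∩ U.sym2) + 1 = #(L ∩ U.sym2) := by
      rw [erase_inter, card_erase_add_one]
      exact mem_inter.2 ⟨heL, mk_mem_sym2_iff.2 ⟨hxU, hyU⟩⟩
    have h3 := card_eq_sum_card_fiberwise (f := c₀) (s := L.erase s(x, y) ∩ U.sym2)
      (t := univ) (fun _ _ => mem_univ _)
    have h4 := sum_le_sum fun i (_ : i ∈ (univ : Finset (Fin m))) => h1 i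
    rw [sum_add_distrib, ← h3] at h4
    have h5 := hH U ⟨x, hxU⟩
    simp only [sum_const, card_univ, Fintype.card_fin, smul_eq_mul, mul_one] at h4
    omega

/-- An acyclic graph with `|V| - 1` edges is a tree. -/
lemma isTree_fromEdgeSet [Nonempty V] {A : Finset (Sym2 V)}
    (hA : (fromEdgeSet (A : Set (Sym2 V))).IsAcyclic) (hdiag : ∀ e ∈ A, ¬ e.IsDiag) :
    #A + 1 ≤ Fintype.card V ∧
      (#A + 1 = Fintype.card V → (fromEdgeSet (A : Set (Sym2 V))).IsTree) := by
  obtain ⟨T, hAT, -, hT⟩ := (connected_top (V := V)).exists_isTree_le_of_le_of_isAcyclic le_top hA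
  have hcard := hT.card_edgeFinset
  have hsub : A ⊆ T.edgeFinset := by
    intro e he
    rw [mem_edgeFinset]
    exact edgeSet_mono hAT (by rw [edgeSet_fromEdgeSet]; exact ⟨mem_coe.2 he, hdiag e he⟩)
  refine ⟨by rw [← hcard]; exact Nat.add_le_add_right (card_le_card hsub) 1, fun h => ?_⟩
  have : A = T.edgeFinset := eq_of_subset_of_card_le hsub (by omega)
  rw [this, coe_edgeFinset, fromEdgeSet_edgeSet]
  exact hT

lemma IsSparseBase.isTreeConnected [Nonempty V] {G : SimpleGraph V} {H : Finset (Sym2 V)}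
    (hm : 0 < m) (hH : IsSparseBase G m H) :
    SimpleGraph.IsTreeConnected m (fromEdgeSet (H : Set (Sym2 V))) := by
  obtain ⟨c, hc⟩ := hH.isSparse.isForestColorable hm
  have hdiag : ∀ i, ∀ e ∈ H.filter (fun e => c e = i), ¬ e.IsDiag := fun i e he =>
    hH.isSparse.not_isDiag (mem_filter.1 he).1
  have h1 := card_eq_sum_card_fiberwise (f := c) (s := H) (t := univ) (fun _ _ => mem_univ _)
  have h2 := hH.card_add
  have h3 : ∑ i : Fin m, (#(H.filter fun e => c e = i) + 1) = ∑ i : Fin m, Fintype.card V := by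
    rw [sum_add_distrib, ← h1]
    simpa using h2
  have h4 := (sum_eq_sum_iff_of_le fun i _ => (isTree_fromEdgeSet (hc i) (hdiag i)).1).1 h3
  refine ⟨fun i => fromEdgeSet (↑(H.filter fun e => c e = i) : Set (Sym2 V)), fun i => ?_,
    fun i => (isTree_fromEdgeSet (hc i) (hdiag i)).2 (h4 i (mem_univ i)), fun i j hij => ?_⟩
  · exact fromEdgeSet_mono (coe_subset.2 (filter_subset _ _))
  · rw [Set.disjoint_left]
    intro e he he'
    rw [edgeSet_fromEdgeSet] at he he'
    exact hij ((mem_filter.1 (mem_coe.1 he.1)).2.symm.trans (mem_filter.1 (mem_coe.1 he'.1)).2)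

end ForestDecomposition

/-- if `((m+1)/2)·iso(G−S) + ω(G−S) ≤ |S|/m + 1` for all `S ⊆ V(G)`, then
`G` has an `m`-tree-connected spanning subgraph `H` with `Δ(H) ≤ 2m+1`, and for any
prescribed vertex `u` one can moreover ensure `d_H(u) ≤ m+1`. -/
theorem tree_connected_factor_of_iso_comp_bound {V : Type*} [Fintype V]
    (G : SimpleGraph V) (m : ℕ) (hm : 0 < m) (u : V)
    (hcond : ∀ S : Finset V, ((m + 1 : ℝ) / 2) * (G.isoCount S : ℝ) + (G.compCount S : ℝ)
      ≤ (S.card : ℝ) / m + 1) :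
    ∃ H : SimpleGraph V, H ≤ G ∧ SimpleGraph.IsTreeConnected m H ∧
      (∀ v, H.degree v ≤ 2 * m + 1) ∧ H.degree u ≤ m + 1 := by
  have : Nonempty V := ⟨u⟩
  obtain ⟨H, hH, hdeg⟩ := exists_isSparseBase_edgeDegree_le (G := G) hm
    (fun c S => mul_card_image_le G m hm hcond c S)
    (fun v => if v = u then m + 1 else 2 * m + 1) (fun S => by
      have h1 : ∑ v ∈ S, (2 * m + 1) ≤
          ∑ v ∈ S, ((if v = u then m + 1 else 2 * m + 1) + if v = u then m else 0) :=
        sum_le_sum fun v _ => by split_ifs <;> omega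
      rw [sum_const, smul_eq_mul, mul_comm, sum_add_distrib, sum_ite_eq'] at h1
      split_ifs at h1 <;> omega)
  have hdegree : ∀ (v) {_ : Fintype ((SimpleGraph.fromEdgeSet (H : Set (Sym2 V))).neighborSet v)},
      (SimpleGraph.fromEdgeSet (H : Set (Sym2 V))).degree v ≤ edgeDegree H v := by
    intro v _
    rw [← SimpleGraph.card_incidenceFinset_eq_degree]
    refine card_le_card fun e he => ?_
    rw [SimpleGraph.mem_incidenceFinset, SimpleGraph.incidenceSet] at he
    have he' := he.1
    rw [SimpleGraph.edgeSet_fromEdgeSet] at he'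
    exact mem_filter.2 ⟨he'.1, he.2⟩
  refine ⟨SimpleGraph.fromEdgeSet (H : Set (Sym2 V)), ?_, hH.isTreeConnected hm, fun v => ?_, ?_⟩
  · intro a b hab
    have := hH.subset (mem_coe.1 ((SimpleGraph.fromEdgeSet_adj _).1 hab).1)
    simpa using this
  · refine le_trans (hdegree v) ((hdeg v).trans ?_)
    split_ifs <;> omega
  · exact le_trans (hdegree u) ((hdeg u).trans (by simp))
end
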